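/- arXiv:2303.08381 — 2 statements merged into one kernel-verified Lean document; each statement's English description precedes it below -/
import Mathlib

section
/- Let x: (0,∞) × ℝ → ℝ³ be the cone of vertex angle π/2 given by x(u,v) = (u/√2)·(cos(√2·v), sin(√2·v), 1), with a smooth unit normal field N. Then the normal bundle immersion f((u,v),t) = (x(u,v), t·N(u,v)) into ℂ³ is Hamiltonian stationary. -/
noncomputable section

open scoped InnerProductSpace

/-- Euclidean 3-space. -/
abbrev E3 : Type := EuclideanSpace ℝ (Fin 3)

/-- ℝ⁶ = ℝ³ × ℝ³, identified with ℂ³. -/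
abbrev V6 : Type := E3 × E3

/-- The domain of the normal bundle immersion: ℝ² × ℝ. -/
abbrev W3 : Type := (ℝ × ℝ) × ℝ

/-- The standard inner product on ℝ⁶ = ℝ³ × ℝ³. -/
def ip6 (v w : V6) : ℝ := ⟪v.1, w.1⟫_ℝ + ⟪v.2, w.2⟫_ℝ

/-- The complex structure J(X, Y) = (−Y, X) on ℝ³ × ℝ³ = ℂ³. -/
def Jc (v : V6) : V6 := (-v.2, v.1)

/-- The normal bundle immersion f(p, t) = (x(p), t·N(p)). -/
def nbi (x N : ℝ × ℝ → E3) : W3 → V6 := fun q => (x q.1, q.2 • N q.1)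

/-- Second derivative of `g` at `q` in directions `v`, `w`. -/
def d2 (g : W3 → V6) (q v w : W3) : V6 := fderiv ℝ (fun y => fderiv ℝ g y w) q v

/-- `n` is orthogonal to the tangent space (range of the differential) of `g` at `q`. -/
def IsNormalAt (g : W3 → V6) (q : W3) (n : V6) : Prop :=
  ∀ v : W3, ip6 n (fderiv ℝ g q v) = 0

/-- `n` is the second fundamental form `h(v, w)` of `g` at `q`: the orthogonal projection of
the second derivative in directions `v`, `w` onto the orthogonal complement of the tangent
space. -/
def IsSFF (g : W3 → V6) (q v w : W3) (n : V6) : Prop :=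
  IsNormalAt g q n ∧ d2 g q v w - n ∈ Set.range ⇑(fderiv ℝ g q)

/-- `v₁, v₂, v₃` is an orthonormal frame at `q` for the metric induced by `g`. -/
def ONFrame (g : W3 → V6) (q : W3) (v₁ v₂ v₃ : W3) : Prop :=
  ip6 (fderiv ℝ g q v₁) (fderiv ℝ g q v₁) = 1 ∧
  ip6 (fderiv ℝ g q v₂) (fderiv ℝ g q v₂) = 1 ∧
  ip6 (fderiv ℝ g q v₃) (fderiv ℝ g q v₃) = 1 ∧
  ip6 (fderiv ℝ g q v₁) (fderiv ℝ g q v₂) = 0 ∧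
  ip6 (fderiv ℝ g q v₁) (fderiv ℝ g q v₃) = 0 ∧
  ip6 (fderiv ℝ g q v₂) (fderiv ℝ g q v₃) = 0

/-- `Hq` is the mean curvature vector of `g` at `q`:
`H = Σᵢ h(ẽᵢ, ẽᵢ)` for an orthonormal frame `ẽ₁, ẽ₂, ẽ₃` of the induced metric. -/
def IsMeanCurvAt (g : W3 → V6) (q : W3) (Hq : V6) : Prop :=
  ∃ v₁ v₂ v₃ : W3, ONFrame g q v₁ v₂ v₃ ∧
    ∃ n₁ n₂ n₃ : V6, IsSFF g q v₁ v₁ n₁ ∧ IsSFF g q v₂ v₂ n₂ ∧ IsSFF g q v₃ v₃ n₃ ∧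
      Hq = n₁ + n₂ + n₃

/-- `u = A_ξ v`, the shape operator of `g` at `q` with respect to the normal vector `ξ`,
characterized by `⟨dg(A_ξ v), dg(w)⟩ = ⟨h(v, w), ξ⟩` for all `w`. -/
def IsShapeAt (g : W3 → V6) (q : W3) (ξ : V6) (v u : W3) : Prop :=
  ∀ w : W3, ∀ n : V6, IsSFF g q v w n →
    ip6 (fderiv ℝ g q u) (fderiv ℝ g q w) = ip6 n ξ

/-- `g` is a Lagrangian immersion at `q`: the differential is injective and `J` maps the
tangent space onto its orthogonal complement. -/
def LagrangianAt (g : W3 → V6) (q : W3) : Prop :=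
  Function.Injective ⇑(fderiv ℝ g q) ∧
    Jc '' Set.range ⇑(fderiv ℝ g q) =
      {u : V6 | ∀ w ∈ Set.range ⇑(fderiv ℝ g q), ip6 u w = 0}

/-- The Maslovian condition at `q` for the mean curvature vector `Hq`: `Hq ≠ 0` and
`A_H(JH)` is a real scalar multiple of `JH` (expressed via the tangent vector `V`
with `dg(V) = J Hq`). -/
def MaslovianAt (g : W3 → V6) (q : W3) (Hq : V6) : Prop :=
  Hq ≠ 0 ∧ ∀ V u : W3, fderiv ℝ g q V = Jc Hq → IsShapeAt g q Hq V u → ∃ c : ℝ, u = c • V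

/-- Standard hypotheses: `U` is a connected open set, `x` is a smooth immersion on `U`, and
`N` is a smooth unit normal field along `x` on `U`. -/
structure SurfaceData (U : Set (ℝ × ℝ)) (x N : ℝ × ℝ → E3) : Prop where
  open_U : IsOpen U
  conn_U : IsConnected U
  smooth_x : ContDiffOn ℝ (⊤ : ℕ∞) x U
  smooth_N : ContDiffOn ℝ (⊤ : ℕ∞) N U
  immersion : ∀ p ∈ U, Function.Injective ⇑(fderiv ℝ x p)
  unit_N : ∀ p ∈ U, ‖N p‖ = 1
  normal_N : ∀ p ∈ U, ∀ v : ℝ × ℝ, ⟪N p, fderiv ℝ x p v⟫_ℝ = 0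

/-- `x` is minimal at `p`: the trace of the shape operator `A = −dN ∘ dx⁻¹` vanishes,
expressed via orthonormal frames of the induced metric. -/
def SurfMinimalAt (x N : ℝ × ℝ → E3) (p : ℝ × ℝ) : Prop :=
  ∀ v₁ v₂ : ℝ × ℝ,
    ⟪fderiv ℝ x p v₁, fderiv ℝ x p v₁⟫_ℝ = 1 →
    ⟪fderiv ℝ x p v₂, fderiv ℝ x p v₂⟫_ℝ = 1 →
    ⟪fderiv ℝ x p v₁, fderiv ℝ x p v₂⟫_ℝ = 0 →
    ⟪fderiv ℝ N p v₁, fderiv ℝ x p v₁⟫_ℝ + ⟪fderiv ℝ N p v₂, fderiv ℝ x p v₂⟫_ℝ = 0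

/-- A rigid motion of ℝ³: `y ↦ S y + c` with `S ∈ SO(3)`. -/
def RigidMotion (Φ : E3 → E3) : Prop :=
  ∃ (S : E3 ≃ₗᵢ[ℝ] E3) (c : E3),
    LinearMap.det (S.toLinearEquiv : E3 →ₗ[ℝ] E3) = 1 ∧ ∀ y, Φ y = S y + c

/-- The circular cone `C_r = {(s·r·cos θ, s·r·sin θ, s)/√(r²+1) : s > 0, θ ∈ ℝ}`. -/
def coneSet (r : ℝ) : Set E3 :=
  { y | ∃ s θ : ℝ, 0 < s ∧
      y 0 = s * r * Real.cos θ / Real.sqrt (r ^ 2 + 1) ∧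
      y 1 = s * r * Real.sin θ / Real.sqrt (r ^ 2 + 1) ∧
      y 2 = s / Real.sqrt (r ^ 2 + 1) }

/-- `x(U)` is contained in a round sphere. -/
def InRoundSphere (U : Set (ℝ × ℝ)) (x : ℝ × ℝ → E3) : Prop :=
  ∃ (c : E3) (ρ : ℝ), 0 < ρ ∧ ∀ p ∈ U, ‖x p - c‖ = ρ

/-- `x(U)` is contained in a circular cylinder. -/
def InCircularCylinder (U : Set (ℝ × ℝ)) (x : ℝ × ℝ → E3) : Prop :=
  ∃ (c w : E3) (ρ : ℝ), ‖w‖ = 1 ∧ 0 < ρ ∧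
    ∀ p ∈ U, ‖(x p - c) - ⟪x p - c, w⟫_ℝ • w‖ = ρ

/-- `x(U)` is contained in a circular cone: the image under a rigid motion of `C_r`, `r ≠ 0`. -/
def InCircularCone (U : Set (ℝ × ℝ)) (x : ℝ × ℝ → E3) : Prop :=
  ∃ r : ℝ, r ≠ 0 ∧ ∃ Φ : E3 → E3, RigidMotion Φ ∧ ∀ p ∈ U, x p ∈ Φ '' coneSet r
/-- The unit ruling direction of the cone `z = √(x² + y²)`. -/
def coneRuling (v : ℝ) : E3 :=
  !₂[Real.cos (Real.sqrt 2 * v) / Real.sqrt 2, Real.sin (Real.sqrt 2 * v) / Real.sqrt 2,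
    1 / Real.sqrt 2]

/-- The unit vector tangent to the parallels of the cone. -/
def coneParallel (v : ℝ) : E3 :=
  !₂[-Real.sin (Real.sqrt 2 * v), Real.cos (Real.sqrt 2 * v), 0]

/-- The outward unit normal of the cone. -/
def coneNormal (v : ℝ) : E3 :=
  !₂[Real.cos (Real.sqrt 2 * v) / Real.sqrt 2, Real.sin (Real.sqrt 2 * v) / Real.sqrt 2,
    -(1 / Real.sqrt 2)]

theorem hasDerivAt_euclidean_three {a b c : ℝ → ℝ} {a' b' c' v : ℝ}
    (ha : HasDerivAt a a' v) (hb : HasDerivAt b b' v) (hc : HasDerivAt c c' v) :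
    HasDerivAt (fun y => (!₂[a y, b y, c y] : E3)) !₂[a', b', c'] v := by
  have h : HasDerivAt (fun y => ![a y, b y, c y]) ![a', b', c'] v := by
    rw [hasDerivAt_pi]
    intro i
    fin_cases i <;> simpa
  exact ((PiLp.continuousLinearEquiv 2 ℝ (fun _ : Fin 3 => ℝ)).symm.hasFDerivAt
    (x := ![a v, b v, c v])).comp_hasDerivAt v h

theorem hasDerivAt_cos_sqrt_two_mul (v : ℝ) :
    HasDerivAt (fun y => Real.cos (Real.sqrt 2 * y))
      (-Real.sin (Real.sqrt 2 * v) * Real.sqrt 2) v := by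
  simpa using ((hasDerivAt_id v).const_mul (Real.sqrt 2)).cos

theorem hasDerivAt_sin_sqrt_two_mul (v : ℝ) :
    HasDerivAt (fun y => Real.sin (Real.sqrt 2 * y))
      (Real.cos (Real.sqrt 2 * v) * Real.sqrt 2) v := by
  simpa using ((hasDerivAt_id v).const_mul (Real.sqrt 2)).sin

theorem hasDerivAt_coneRuling (v : ℝ) : HasDerivAt coneRuling (coneParallel v) v := by
  refine (hasDerivAt_euclidean_three
    ((hasDerivAt_cos_sqrt_two_mul v).div_const (Real.sqrt 2))
    ((hasDerivAt_sin_sqrt_two_mul v).div_const (Real.sqrt 2))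
    (hasDerivAt_const v (1 / Real.sqrt 2))).congr_deriv ?_
  simp [coneParallel, neg_div]

theorem hasDerivAt_coneNormal (v : ℝ) : HasDerivAt coneNormal (coneParallel v) v := by
  refine (hasDerivAt_euclidean_three
    ((hasDerivAt_cos_sqrt_two_mul v).div_const (Real.sqrt 2))
    ((hasDerivAt_sin_sqrt_two_mul v).div_const (Real.sqrt 2))
    (hasDerivAt_const v (-(1 / Real.sqrt 2)))).congr_deriv ?_
  simp [coneParallel, neg_div]

theorem hasDerivAt_coneParallel (v : ℝ) :
    HasDerivAt coneParallel (-(coneRuling v + coneNormal v)) v := by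
  refine (hasDerivAt_euclidean_three (hasDerivAt_sin_sqrt_two_mul v).neg
    (hasDerivAt_cos_sqrt_two_mul v) (hasDerivAt_const v (0 : ℝ))).congr_deriv ?_
  have h2 : Real.sqrt 2 ^ 2 = 2 := Real.sq_sqrt (by norm_num)
  ext i
  fin_cases i <;> simp [coneRuling, coneNormal] <;> field_simp <;> rw [h2] <;> ring

theorem inner_coneRuling_self (v : ℝ) : ⟪coneRuling v, coneRuling v⟫_ℝ = 1 := by
  have h2 : Real.sqrt 2 ^ 2 = 2 := Real.sq_sqrt (by norm_num)
  simp only [coneRuling, PiLp.inner_apply, Fin.sum_univ_three, RCLike.inner_apply, conj_trivial]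
  simp only [Matrix.cons_val]
  field_simp
  linear_combination Real.sin_sq_add_cos_sq (Real.sqrt 2 * v) - h2

theorem inner_coneParallel_self (v : ℝ) : ⟪coneParallel v, coneParallel v⟫_ℝ = 1 := by
  simp only [coneParallel, PiLp.inner_apply, Fin.sum_univ_three, RCLike.inner_apply, conj_trivial]
  simp only [Matrix.cons_val]
  linear_combination Real.sin_sq_add_cos_sq (Real.sqrt 2 * v)

theorem inner_coneNormal_self (v : ℝ) : ⟪coneNormal v, coneNormal v⟫_ℝ = 1 := by
  have h2 : Real.sqrt 2 ^ 2 = 2 := Real.sq_sqrt (by norm_num)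
  simp only [coneNormal, PiLp.inner_apply, Fin.sum_univ_three, RCLike.inner_apply, conj_trivial]
  simp only [Matrix.cons_val]
  field_simp
  linear_combination Real.sin_sq_add_cos_sq (Real.sqrt 2 * v) - h2

theorem inner_coneRuling_coneParallel (v : ℝ) : ⟪coneRuling v, coneParallel v⟫_ℝ = 0 := by
  simp [coneRuling, coneParallel, PiLp.inner_apply, Fin.sum_univ_three]
  ring

theorem inner_coneNormal_coneParallel (v : ℝ) : ⟪coneNormal v, coneParallel v⟫_ℝ = 0 := by
  simp [coneNormal, coneParallel, PiLp.inner_apply, Fin.sum_univ_three]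
  ring

theorem inner_coneRuling_coneNormal (v : ℝ) : ⟪coneRuling v, coneNormal v⟫_ℝ = 0 := by
  simp [coneRuling, coneNormal, PiLp.inner_apply, Fin.sum_univ_three]
  field_simp
  linear_combination Real.sin_sq_add_cos_sq (Real.sqrt 2 * v)

theorem inner_coneFrame (v a b c a' b' c' : ℝ) :
    ⟪a • coneRuling v + b • coneParallel v + c • coneNormal v,
      a' • coneRuling v + b' • coneParallel v + c' • coneNormal v⟫_ℝ =
      a * a' + b * b' + c * c' := by
  have h1 := inner_coneRuling_coneParallel v
  have h2 := inner_coneNormal_coneParallel v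
  have h3 := inner_coneRuling_coneNormal v
  have h1' := (real_inner_comm _ _).trans h1
  have h2' := (real_inner_comm _ _).trans h2
  have h3' := (real_inner_comm _ _).trans h3
  simp only [inner_add_left, inner_add_right, real_inner_smul_left, real_inner_smul_right,
    h1, h2, h3, h1', h2', h3', inner_coneRuling_self, inner_coneParallel_self,
    inner_coneNormal_self]
  ring

theorem coneFrame_inj {v a b c a' b' c' : ℝ}
    (h : a • coneRuling v + b • coneParallel v + c • coneNormal v =
      a' • coneRuling v + b' • coneParallel v + c' • coneNormal v) :
    a = a' ∧ b = b' ∧ c = c' := by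
  refine ⟨?_, ?_, ?_⟩
  · have := congrArg (fun y => ⟪y, (1 : ℝ) • coneRuling v + (0 : ℝ) • coneParallel v +
      (0 : ℝ) • coneNormal v⟫_ℝ) h
    simpa only [inner_coneFrame, mul_one, mul_zero, add_zero] using this
  · have := congrArg (fun y => ⟪y, (0 : ℝ) • coneRuling v + (1 : ℝ) • coneParallel v +
      (0 : ℝ) • coneNormal v⟫_ℝ) h
    simpa only [inner_coneFrame, mul_one, mul_zero, add_zero, zero_add] using this
  · have := congrArg (fun y => ⟪y, (0 : ℝ) • coneRuling v + (0 : ℝ) • coneParallel v +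
      (1 : ℝ) • coneNormal v⟫_ℝ) h
    simpa only [inner_coneFrame, mul_one, mul_zero, zero_add] using this

theorem eq_smul_coneNormal {y : E3} {v : ℝ} (h1 : ⟪y, coneRuling v⟫_ℝ = 0)
    (h2 : ⟪y, coneParallel v⟫_ℝ = 0) : y = ⟪y, coneNormal v⟫_ℝ • coneNormal v := by
  have h := Real.sin_sq_add_cos_sq (Real.sqrt 2 * v)
  have hs : Real.sqrt 2 ^ 2 = 2 := Real.sq_sqrt (by norm_num)
  simp only [coneRuling, coneParallel, coneNormal, PiLp.inner_apply, Fin.sum_univ_three] at *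
  simp at h1 h2
  field_simp at h1
  set c := Real.cos (Real.sqrt 2 * v)
  set s := Real.sin (Real.sqrt 2 * v)
  ext i
  fin_cases i <;> simp <;> field_simp <;> rw [hs]
  · linear_combination -2 * y 0 * h - 2 * s * h2 + c * h1
  · linear_combination -2 * y 1 * h + 2 * c * h2 + s * h1
  · linear_combination h1

/-- The parameter `v` as a linear function on the domain of the normal bundle immersion. -/
def coneAngle : W3 →L[ℝ] ℝ :=
  (ContinuousLinearMap.snd ℝ ℝ ℝ).comp (ContinuousLinearMap.fst ℝ (ℝ × ℝ) ℝ)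

theorem hasFDerivAt_smul_coneAngle {a : W3 → ℝ} {a' : W3 →L[ℝ] ℝ} {e : ℝ → E3} {e' : E3}
    {q : W3} (ha : HasFDerivAt a a' q) (he : HasDerivAt e e' q.1.2) :
    HasFDerivAt (fun y => a y • e y.1.2)
      (a q • coneAngle.smulRight e' + a'.smulRight (e q.1.2)) q := by
  have h : HasFDerivAt (fun y : W3 => e y.1.2) (coneAngle.smulRight e') q := by
    refine (HasFDerivAt.comp q (g := e) (f := fun y : W3 => y.1.2) he.hasFDerivAt
      coneAngle.hasFDerivAt).congr_fderiv ?_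
    ext <;> simp [coneAngle]
  exact ha.smul h

theorem hasFDerivAt_u (q : W3) : HasFDerivAt (fun y : W3 => y.1.1)
    ((ContinuousLinearMap.fst ℝ ℝ ℝ).comp (ContinuousLinearMap.fst ℝ (ℝ × ℝ) ℝ)) q :=
  ((ContinuousLinearMap.fst ℝ ℝ ℝ).comp (ContinuousLinearMap.fst ℝ (ℝ × ℝ) ℝ)).hasFDerivAt

theorem hasFDerivAt_t (q : W3) : HasFDerivAt (fun y : W3 => y.2)
    (ContinuousLinearMap.snd ℝ (ℝ × ℝ) ℝ) q :=
  (ContinuousLinearMap.snd ℝ (ℝ × ℝ) ℝ).hasFDerivAt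

/-- The normal bundle immersion of the cone with unit normal `ε • coneNormal`. -/
def coneBundle (ε : ℝ) (q : W3) : V6 :=
  (q.1.1 • coneRuling q.1.2, (ε * q.2) • coneNormal q.1.2)

theorem fderiv_coneBundle (ε : ℝ) (q w : W3) :
    fderiv ℝ (coneBundle ε) q w =
      (w.1.1 • coneRuling q.1.2 + (q.1.1 * w.1.2) • coneParallel q.1.2 +
          (0 : ℝ) • coneNormal q.1.2,
        (0 : ℝ) • coneRuling q.1.2 + (ε * q.2 * w.1.2) • coneParallel q.1.2 +
          (ε * w.2) • coneNormal q.1.2) := by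
  have h := (hasFDerivAt_smul_coneAngle (hasFDerivAt_u q) (hasDerivAt_coneRuling q.1.2)).prodMk
    (hasFDerivAt_smul_coneAngle ((hasFDerivAt_t q).const_mul ε) (hasDerivAt_coneNormal q.1.2))
  have h' : fderiv ℝ (coneBundle ε) q = _ := h.fderiv
  rw [h']
  ext i <;> simp [coneAngle] <;> ring

theorem d2_coneBundle (ε : ℝ) (q w : W3) :
    d2 (coneBundle ε) q w w =
      ((-(q.1.1 * w.1.2 ^ 2)) • coneRuling q.1.2 + (2 * (w.1.1 * w.1.2)) • coneParallel q.1.2 +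
          (-(q.1.1 * w.1.2 ^ 2)) • coneNormal q.1.2,
        (-(ε * q.2 * w.1.2 ^ 2)) • coneRuling q.1.2 +
          (2 * ε * (w.1.2 * w.2)) • coneParallel q.1.2 +
          (-(ε * q.2 * w.1.2 ^ 2)) • coneNormal q.1.2) := by
  have h := (((hasFDerivAt_smul_coneAngle (hasFDerivAt_const w.1.1 q)
      (hasDerivAt_coneRuling q.1.2)).add
    (hasFDerivAt_smul_coneAngle ((hasFDerivAt_u q).mul_const w.1.2)
      (hasDerivAt_coneParallel q.1.2))).add
    (hasFDerivAt_smul_coneAngle (hasFDerivAt_const (0 : ℝ) q)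
      (hasDerivAt_coneNormal q.1.2))).prodMk
    (((hasFDerivAt_smul_coneAngle (hasFDerivAt_const (0 : ℝ) q)
      (hasDerivAt_coneRuling q.1.2)).add
    (hasFDerivAt_smul_coneAngle (((hasFDerivAt_t q).const_mul ε).mul_const w.1.2)
      (hasDerivAt_coneParallel q.1.2))).add
    (hasFDerivAt_smul_coneAngle (hasFDerivAt_const (ε * w.2) q)
      (hasDerivAt_coneNormal q.1.2)))
  simp only [d2, fderiv_coneBundle]
  refine (congrArg (fun L : W3 →L[ℝ] V6 => L w) h.fderiv).trans ?_
  ext i <;> simp [coneAngle] <;> ring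

theorem gram_columns {ρ a₁ b₁ c₁ a₂ b₂ c₂ a₃ b₃ c₃ : ℝ} (hρ : 0 < ρ)
    (h11 : a₁ * a₁ + ρ * (b₁ * b₁) + c₁ * c₁ = 1)
    (h22 : a₂ * a₂ + ρ * (b₂ * b₂) + c₂ * c₂ = 1)
    (h33 : a₃ * a₃ + ρ * (b₃ * b₃) + c₃ * c₃ = 1)
    (h12 : a₁ * a₂ + ρ * (b₁ * b₂) + c₁ * c₂ = 0)
    (h13 : a₁ * a₃ + ρ * (b₁ * b₃) + c₁ * c₃ = 0)
    (h23 : a₂ * a₃ + ρ * (b₂ * b₃) + c₂ * c₃ = 0) :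
    a₁ ^ 2 + a₂ ^ 2 + a₃ ^ 2 = 1 ∧ b₁ ^ 2 + b₂ ^ 2 + b₃ ^ 2 = 1 / ρ ∧
      c₁ ^ 2 + c₂ ^ 2 + c₃ ^ 2 = 1 ∧ a₁ * b₁ + a₂ * b₂ + a₃ * b₃ = 0 ∧
      b₁ * c₁ + b₂ * c₂ + b₃ * c₃ = 0 ∧ a₁ * c₁ + a₂ * c₂ + a₃ * c₃ = 0 := by
  have h : !![a₁, b₁, c₁; a₂, b₂, c₂; a₃, b₃, c₃] *
      !![a₁, a₂, a₃; ρ * b₁, ρ * b₂, ρ * b₃; c₁, c₂, c₃] = 1 := by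
    ext i j
    fin_cases i <;> fin_cases j <;>
      simp [Matrix.mul_apply, Fin.sum_univ_three] <;> linarith
  rw [mul_eq_one_comm] at h
  have e (i j : Fin 3) := congrFun (congrFun h i) j
  have e00 := e 0 0
  have e01 := e 0 1
  have e02 := e 0 2
  have e11 := e 1 1
  have e21 := e 2 1
  have e22 := e 2 2
  simp [Matrix.mul_apply, Fin.sum_univ_three] at e00 e01 e02 e11 e21 e22
  refine ⟨by linarith, ?_, by linarith, by linarith, by linarith, by linarith⟩
  field_simp
  linarith

theorem ONFrame.gram_columns_coneBundle {ε : ℝ} (hε : ε ^ 2 = 1) {q v₁ v₂ v₃ : W3}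
    (hq : 0 < q.1.1) (h : ONFrame (coneBundle ε) q v₁ v₂ v₃) :
    v₁.1.1 ^ 2 + v₂.1.1 ^ 2 + v₃.1.1 ^ 2 = 1 ∧
      v₁.1.2 ^ 2 + v₂.1.2 ^ 2 + v₃.1.2 ^ 2 = 1 / (q.1.1 ^ 2 + q.2 ^ 2) ∧
      v₁.2 ^ 2 + v₂.2 ^ 2 + v₃.2 ^ 2 = 1 ∧
      v₁.1.1 * v₁.1.2 + v₂.1.1 * v₂.1.2 + v₃.1.1 * v₃.1.2 = 0 ∧
      v₁.1.2 * v₁.2 + v₂.1.2 * v₂.2 + v₃.1.2 * v₃.2 = 0 ∧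
      v₁.1.1 * v₁.2 + v₂.1.1 * v₂.2 + v₃.1.1 * v₃.2 = 0 := by
  obtain ⟨h11, h22, h33, h12, h13, h23⟩ := h
  have key (v w : W3) : ip6 (fderiv ℝ (coneBundle ε) q v) (fderiv ℝ (coneBundle ε) q w) =
      v.1.1 * w.1.1 + (q.1.1 ^ 2 + q.2 ^ 2) * (v.1.2 * w.1.2) + v.2 * w.2 := by
    simp only [ip6, fderiv_coneBundle, inner_coneFrame]
    linear_combination (q.2 ^ 2 * (v.1.2 * w.1.2) + v.2 * w.2) * hε
  rw [key] at h11 h22 h33 h12 h13 h23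
  exact gram_columns (by positivity) h11 h22 h33 h12 h13 h23

/-- The vector `J H` of the normal bundle of the cone. -/
theorem Jc_meanCurv_coneBundle {ε : ℝ} (hε : ε ^ 2 = 1) {q V : W3} {Hq : V6}
    (hq : 0 < q.1.1) (hH : IsMeanCurvAt (coneBundle ε) q Hq)
    (hV : fderiv ℝ (coneBundle ε) q V = Jc Hq) :
    fderiv ℝ (coneBundle ε) q V =
      ((ε * q.2 * (q.1.1 ^ 2 + q.2 ^ 2)⁻¹) • coneRuling q.1.2,
        (-(q.1.1 * (q.1.1 ^ 2 + q.2 ^ 2)⁻¹)) • coneNormal q.1.2) := by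
  obtain ⟨v₁, v₂, v₃, hF, n₁, n₂, n₃, ⟨-, z₁, h₁⟩, ⟨-, z₂, h₂⟩, ⟨-, z₃, h₃⟩, rfl⟩ := hH
  obtain ⟨-, hbb, -, hab, hbc, -⟩ := hF.gram_columns_coneBundle hε hq
  rw [eq_sub_iff_add_eq, ← eq_sub_iff_add_eq'] at h₁ h₂ h₃
  rw [fderiv_coneBundle, d2_coneBundle] at h₁ h₂ h₃
  rw [h₁, h₂, h₃, fderiv_coneBundle, Jc, Prod.mk.injEq] at hV
  set S := v₁.1.2 ^ 2 + v₂.1.2 ^ 2 + v₃.1.2 ^ 2 with hS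
  rw [one_div] at hbb
  rw [fderiv_coneBundle, ← hbb]
  obtain ⟨hV1, hV2⟩ := hV
  have hV1' : V.1.1 • coneRuling q.1.2 + (q.1.1 * V.1.2) • coneParallel q.1.2 +
      (0 : ℝ) • coneNormal q.1.2 = (ε * q.2 * S) • coneRuling q.1.2 +
      (ε * q.2 * (z₁.1.2 + z₂.1.2 + z₃.1.2) -
        2 * ε * (v₁.1.2 * v₁.2 + v₂.1.2 * v₂.2 + v₃.1.2 * v₃.2)) • coneParallel q.1.2 +
      (ε * q.2 * S + ε * (z₁.2 + z₂.2 + z₃.2)) • coneNormal q.1.2 := by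
    rw [hV1, hS]
    simp only [Prod.snd_add, Prod.snd_sub]
    module
  have hV2' : (0 : ℝ) • coneRuling q.1.2 + (ε * q.2 * V.1.2) • coneParallel q.1.2 +
      (ε * V.2) • coneNormal q.1.2 =
      (-(q.1.1 * S) - (z₁.1.1 + z₂.1.1 + z₃.1.1)) • coneRuling q.1.2 +
      (2 * (v₁.1.1 * v₁.1.2 + v₂.1.1 * v₂.1.2 + v₃.1.1 * v₃.1.2) -
        q.1.1 * (z₁.1.2 + z₂.1.2 + z₃.1.2)) • coneParallel q.1.2 +
      (-(q.1.1 * S)) • coneNormal q.1.2 := by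
    rw [hV2, hS]
    simp only [Prod.fst_add, Prod.fst_sub]
    module
  obtain ⟨ha, hb, -⟩ := coneFrame_inj hV1'
  obtain ⟨-, hb', hc⟩ := coneFrame_inj hV2'
  have hβ : V.1.2 = 0 := by
    have : (q.1.1 ^ 2 + q.2 ^ 2) * V.1.2 = 0 := by
      rw [hbc] at hb
      rw [hab] at hb'
      linear_combination q.1.1 * hb + ε * q.2 * hb' - q.2 ^ 2 * V.1.2 * hε
    exact (mul_eq_zero.mp this).resolve_left (by positivity)
  rw [ha, hβ, hc]
  simp

theorem fderiv_Jc_meanCurv_coneBundle (ε : ℝ) {q : W3} (hq : 0 < q.1.1) (w : W3) :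
    fderiv ℝ (fun y : W3 =>
      (((ε * y.2 * (y.1.1 ^ 2 + y.2 ^ 2)⁻¹) • coneRuling y.1.2,
        (-(y.1.1 * (y.1.1 ^ 2 + y.2 ^ 2)⁻¹)) • coneNormal y.1.2) : V6)) q w =
      ((ε * w.2 * (q.1.1 ^ 2 + q.2 ^ 2)⁻¹ - 2 * ε * q.2 * (q.1.1 * w.1.1 + q.2 * w.2) *
            ((q.1.1 ^ 2 + q.2 ^ 2)⁻¹) ^ 2) • coneRuling q.1.2 +
          (ε * q.2 * (q.1.1 ^ 2 + q.2 ^ 2)⁻¹ * w.1.2) • coneParallel q.1.2 +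
          (0 : ℝ) • coneNormal q.1.2,
        (0 : ℝ) • coneRuling q.1.2 +
          (-(q.1.1 * (q.1.1 ^ 2 + q.2 ^ 2)⁻¹ * w.1.2)) • coneParallel q.1.2 +
          (-(w.1.1 * (q.1.1 ^ 2 + q.2 ^ 2)⁻¹) + 2 * q.1.1 * (q.1.1 * w.1.1 + q.2 * w.2) *
            ((q.1.1 ^ 2 + q.2 ^ 2)⁻¹) ^ 2) • coneNormal q.1.2) := by
  have hne : q.1.1 ^ 2 + q.2 ^ 2 ≠ 0 := by positivity
  have hr := (hasDerivAt_inv hne).comp_hasFDerivAt q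
    (((hasFDerivAt_u q).pow 2).add ((hasFDerivAt_t q).pow 2))
  have h := (hasFDerivAt_smul_coneAngle (((hasFDerivAt_t q).const_mul ε).mul hr)
      (hasDerivAt_coneRuling q.1.2)).prodMk
    (hasFDerivAt_smul_coneAngle ((hasFDerivAt_u q).mul hr).neg (hasDerivAt_coneNormal q.1.2))
  have h' := h.fderiv
  refine (congrArg (fun L : W3 →L[ℝ] V6 => L w) h').trans ?_
  ext i <;> simp [coneAngle] <;> ring

theorem exists_normal_eq_smul_coneNormal {x N : ℝ × ℝ → E3}
    (hx : x = fun p => p.1 • coneRuling p.2)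
    (hN : ContDiffOn ℝ (⊤ : ℕ∞) N {p : ℝ × ℝ | 0 < p.1})
    (hNunit : ∀ p : ℝ × ℝ, 0 < p.1 → ‖N p‖ = 1)
    (hNorth : ∀ p : ℝ × ℝ, 0 < p.1 → ∀ v : ℝ × ℝ, ⟪N p, fderiv ℝ x p v⟫_ℝ = 0) :
    ∃ ε : ℝ, ε ^ 2 = 1 ∧ ∀ p : ℝ × ℝ, 0 < p.1 → N p = ε • coneNormal p.2 := by
  have hdx (p w : ℝ × ℝ) :
      fderiv ℝ x p w = w.1 • coneRuling p.2 + (p.1 * w.2) • coneParallel p.2 := by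
    have h := (hasFDerivAt_fst (𝕜 := ℝ) (p := p)).smul
      ((hasDerivAt_coneRuling p.2).hasFDerivAt.comp p (hasFDerivAt_snd (𝕜 := ℝ) (p := p)))
    rw [hx]
    refine (congrArg (fun L : ℝ × ℝ →L[ℝ] E3 => L w) h.fderiv).trans ?_
    ext i
    simp
    ring
  have hNn (p : ℝ × ℝ) (hp : 0 < p.1) : N p = ⟪N p, coneNormal p.2⟫_ℝ • coneNormal p.2 := by
    apply eq_smul_coneNormal
    · simpa [hdx] using hNorth p hp (1, 0)
    · simpa [hdx, inner_smul_right, hp.ne'] using hNorth p hp (0, 1)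
  have hsq : Set.EqOn ((fun p : ℝ × ℝ => ⟪N p, coneNormal p.2⟫_ℝ) ^ 2) 1 {p | 0 < p.1} := by
    intro p hp
    have h1 : ⟪N p, N p⟫_ℝ = 1 := by rw [real_inner_self_eq_norm_sq, hNunit p hp]; norm_num
    rw [hNn p hp, real_inner_smul_left, real_inner_smul_right, inner_coneNormal_self] at h1
    simp only [Pi.pow_apply, Pi.one_apply]
    linarith
  have hconn : IsPreconnected {p : ℝ × ℝ | 0 < p.1} := by
    have : Convex ℝ {p : ℝ × ℝ | 0 < p.1} :=
      (convex_Ioi (0 : ℝ)).linear_preimage (LinearMap.fst ℝ ℝ ℝ)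
    exact this.isPreconnected
  have hcn : Continuous coneNormal :=
    continuous_iff_continuousAt.mpr fun v => (hasDerivAt_coneNormal v).continuousAt
  have hcont : ContinuousOn (fun p : ℝ × ℝ => ⟪N p, coneNormal p.2⟫_ℝ) {p | 0 < p.1} :=
    hN.continuousOn.inner (hcn.comp continuous_snd).continuousOn
  rcases hconn.eq_one_or_eq_neg_one_of_sq_eq hcont hsq with h | h
  · refine ⟨1, by norm_num, fun p hp => (hNn p hp).trans ?_⟩
    rw [show ⟪N p, coneNormal p.2⟫_ℝ = 1 from h hp]
  · refine ⟨-1, by norm_num, fun p hp => (hNn p hp).trans ?_⟩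
    rw [show ⟪N p, coneNormal p.2⟫_ℝ = -1 from h hp]

/-- The normal bundle of the cone of vertex angle π/2,
`x(u,v) = (u/√2)(cos(√2 v), sin(√2 v), 1)`, is Hamiltonian stationary. -/
theorem cone_pi_div_two_hamiltonian_stationary (x N : ℝ × ℝ → E3)
    (hx : ∀ u v : ℝ,
      x (u, v) 0 = u / Real.sqrt 2 * Real.cos (Real.sqrt 2 * v) ∧
      x (u, v) 1 = u / Real.sqrt 2 * Real.sin (Real.sqrt 2 * v) ∧
      x (u, v) 2 = u / Real.sqrt 2)
    (hN : ContDiffOn ℝ (⊤ : ℕ∞) N {p : ℝ × ℝ | 0 < p.1})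
    (hNunit : ∀ p : ℝ × ℝ, 0 < p.1 → ‖N p‖ = 1)
    (hNorth : ∀ p : ℝ × ℝ, 0 < p.1 → ∀ v : ℝ × ℝ, ⟪N p, fderiv ℝ x p v⟫_ℝ = 0)
    (H : W3 → V6) (hH : ∀ q : W3, 0 < q.1.1 → IsMeanCurvAt (nbi x N) q (H q))
    (V : W3 → W3) (hV : ∀ q : W3, 0 < q.1.1 → fderiv ℝ (nbi x N) q (V q) = Jc (H q)) :
    ∀ q : W3, 0 < q.1.1 → ∀ v₁ v₂ v₃ : W3, ONFrame (nbi x N) q v₁ v₂ v₃ →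
      ip6 (fderiv ℝ (fun y => fderiv ℝ (nbi x N) y (V y)) q v₁)
          (fderiv ℝ (nbi x N) q v₁) +
      ip6 (fderiv ℝ (fun y => fderiv ℝ (nbi x N) y (V y)) q v₂)
          (fderiv ℝ (nbi x N) q v₂) +
      ip6 (fderiv ℝ (fun y => fderiv ℝ (nbi x N) y (V y)) q v₃)
          (fderiv ℝ (nbi x N) q v₃) = 0 := by
  have hxe : x = fun p => p.1 • coneRuling p.2 := by
    funext ⟨u, v⟩
    obtain ⟨h0, h1, h2⟩ := hx u v
    ext i
    fin_cases i
    · simp [coneRuling, h0]; ring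
    · simp [coneRuling, h1]; ring
    · simp [coneRuling, h2]; ring
  obtain ⟨ε, hε, hNε⟩ := exists_normal_eq_smul_coneNormal hxe hN hNunit hNorth
  have hopen : IsOpen {q : W3 | 0 < q.1.1} :=
    isOpen_lt continuous_const (continuous_fst.comp continuous_fst)
  have heq : Set.EqOn (nbi x N) (coneBundle ε) {q | 0 < q.1.1} := by
    intro q hq
    simp only [nbi, coneBundle, hxe, hNε q.1 hq, smul_smul, mul_comm]
  have hev (q : W3) (hq : 0 < q.1.1) : nbi x N =ᶠ[nhds q] coneBundle ε :=
    heq.eventuallyEq_of_mem (hopen.mem_nhds hq)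
  have hfd (q : W3) (hq : 0 < q.1.1) :
      fderiv ℝ (nbi x N) q = fderiv ℝ (coneBundle ε) q := (hev q hq).fderiv_eq
  have hd2 (q v w : W3) (hq : 0 < q.1.1) : d2 (nbi x N) q v w = d2 (coneBundle ε) q v w := by
    have : (fun y => fderiv ℝ (nbi x N) y w) =ᶠ[nhds q] fun y => fderiv ℝ (coneBundle ε) y w := by
      filter_upwards [hopen.mem_nhds hq] with y hy
      rw [hfd y hy]
    rw [d2, d2, this.fderiv_eq]
  intro q hq v₁ v₂ v₃ hF
  have hJ : (fun y => fderiv ℝ (nbi x N) y (V y)) =ᶠ[nhds q] fun y : W3 =>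
      (((ε * y.2 * (y.1.1 ^ 2 + y.2 ^ 2)⁻¹) • coneRuling y.1.2,
        (-(y.1.1 * (y.1.1 ^ 2 + y.2 ^ 2)⁻¹)) • coneNormal y.1.2) : V6) := by
    filter_upwards [hopen.mem_nhds hq] with y hy
    have hHy := hH y hy
    have hVy := hV y hy
    simp only [IsMeanCurvAt, ONFrame, IsSFF, IsNormalAt, hfd y hy, hd2 y _ _ hy] at hHy
    rw [hfd y hy] at hVy ⊢
    exact Jc_meanCurv_coneBundle hε hy hHy hVy
  simp only [ONFrame, hfd q hq] at hF
  obtain ⟨haa, -, hcc, -, -, hac⟩ := ONFrame.gram_columns_coneBundle hε hq hF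
  rw [hJ.fderiv_eq, hfd q hq]
  simp only [ip6, fderiv_Jc_meanCurv_coneBundle ε hq, fderiv_coneBundle, inner_coneFrame]
  set R := (q.1.1 ^ 2 + q.2 ^ 2)⁻¹
  linear_combination (-2 * ε * q.1.1 * q.2 * R ^ 2) * haa + (2 * ε * q.1.1 * q.2 * R ^ 2) * hcc +
    (ε * R - 2 * ε * q.2 ^ 2 * R ^ 2 - ε * R + 2 * ε * q.1.1 ^ 2 * R ^ 2) * hac
end
end

section
/- Let x: U → ℝ³ be a smooth immersed surface with unit normal N whose principal curvatures a and b (the eigenvalues of the shape operator) are nowhere zero on the connected set U. If the normal bundle immersion f(p,t) = (x(p), t·N(p)) is a Maslovian Lagrangian immersion into ℂ³, then a and b are constant on U. -/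
noncomputable section

open scoped InnerProductSpace

section Ip6

lemma ip6_comm (v w : V6) : ip6 v w = ip6 w v := by
  simp only [ip6, real_inner_comm]

lemma ip6_add_left (u v w : V6) : ip6 (u + v) w = ip6 u w + ip6 v w := by
  simp only [ip6, Prod.fst_add, Prod.snd_add, inner_add_left]; ring

lemma ip6_smul_left (c : ℝ) (v w : V6) : ip6 (c • v) w = c * ip6 v w := by
  simp only [ip6, Prod.smul_fst, Prod.smul_snd, real_inner_smul_left]; ring

/-- The standard inner product on ℝ⁶ as a bilinear map. -/
def ip6Bilin : V6 →ₗ[ℝ] V6 →ₗ[ℝ] ℝ :=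
  LinearMap.mk₂ ℝ ip6 ip6_add_left ip6_smul_left
    (fun u v w => by simp only [ip6_comm u, ip6_add_left])
    (fun c u v => by simp only [ip6_comm u, ip6_smul_left, smul_eq_mul])

lemma ip6Bilin_apply (v w : V6) : ip6Bilin v w = ip6 v w := rfl

lemma ip6_smul_right (c : ℝ) (v w : V6) : ip6 v (c • w) = c * ip6 v w := by
  simp only [← ip6Bilin_apply, map_smul, smul_eq_mul]

lemma ip6_sub_left (u v w : V6) : ip6 (u - v) w = ip6 u w - ip6 v w := by
  simp only [← ip6Bilin_apply, map_sub, LinearMap.sub_apply]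

lemma ip6_sum_left {ι : Type*} (s : Finset ι) (v : ι → V6) (w : V6) :
    ip6 (∑ i ∈ s, v i) w = ∑ i ∈ s, ip6 (v i) w := by
  simp only [← ip6Bilin_apply, map_sum, LinearMap.sum_apply]

lemma ip6_sum_right {ι : Type*} (s : Finset ι) (v : V6) (w : ι → V6) :
    ip6 v (∑ i ∈ s, w i) = ∑ i ∈ s, ip6 v (w i) := by
  simp only [← ip6Bilin_apply, map_sum]

/-- The complex structure as a linear map. -/
def jcLin : V6 →ₗ[ℝ] V6 where
  toFun := Jc
  map_add' v w := by ext <;> simp [Jc, add_comm]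
  map_smul' c v := by ext <;> simp [Jc]

lemma jcLin_apply (v : V6) : jcLin v = Jc v := rfl

lemma Jc_sum_smul {ι : Type*} (s : Finset ι) (c : ι → ℝ) (v : ι → V6) :
    Jc (∑ i ∈ s, c i • v i) = ∑ i ∈ s, c i • Jc (v i) := by
  simp only [← jcLin_apply, map_sum, map_smul]

lemma Jc_Jc (v : V6) : Jc (Jc v) = -v := by
  ext <;> simp [Jc]

end Ip6

/-- The Maslovian condition in components: with respect to an orthogonal tangent frame
`e`, the vector `V` dual to the mean curvature is an eigenvector of the cubic form `C`. -/
lemma MaslovianAt.exists_eigenvalue {g : W3 → V6} {q : W3} {B : W3 →ₗ[ℝ] W3 →ₗ[ℝ] V6}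
    (hB : ∀ v w, d2 g q v w = B v w) {e : Fin 3 → W3} {E : Fin 3 → V6}
    (hE : ∀ i, fderiv ℝ g q (e i) = E i) (hspan : ∀ w, ∃ c : Fin 3 → ℝ, w = ∑ i, c i • e i)
    {G : Fin 3 → ℝ} (hG : ∀ i, 0 < G i)
    (hEE : ∀ i j, ip6 (E i) (E j) = if i = j then G i else 0)
    (hJE : ∀ i j, ip6 (Jc (E i)) (E j) = 0)
    (hdec : ∀ Y : V6, Y = ∑ i, (ip6 Y (E i) / G i) • E i +
      ∑ i, (ip6 Y (Jc (E i)) / G i) • Jc (E i))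
    {C : Fin 3 → Fin 3 → Fin 3 → ℝ} (hC : ∀ i j k, C i j k = ip6 (B (e i) (e j)) (Jc (E k)))
    {V : Fin 3 → ℝ} (hV : ∀ k, V k = -(∑ i, C i i k / G i) / G k)
    (hM : ∀ Hq : V6, IsMeanCurvAt g q Hq → MaslovianAt g q Hq) :
    V ≠ 0 ∧ ∃ c : ℝ, ∀ j, ∑ i, ∑ k, V i * V k * C i j k = c * (G j * V j) := by
  set L := fderiv ℝ g q with hL
  have hLsum : ∀ c : Fin 3 → ℝ, L (∑ i, c i • e i) = ∑ i, c i • E i := fun c => by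
    simp only [map_sum, map_smul, hE]
  have hnormal : ∀ c : Fin 3 → ℝ, IsNormalAt g q (∑ k, c k • Jc (E k)) := by
    intro c v
    obtain ⟨d, rfl⟩ := hspan v
    rw [← hL, hLsum]
    simp [ip6_sum_left, ip6_sum_right, ip6_smul_left, ip6_smul_right, hJE]
  have hsff : ∀ v w, IsSFF g q v w (∑ k, (ip6 (B v w) (Jc (E k)) / G k) • Jc (E k)) := by
    intro v w
    refine ⟨hnormal _, ∑ i, (ip6 (B v w) (E i) / G i) • e i, ?_⟩
    rw [← hL, hLsum, hB]
    exact eq_sub_of_add_eq (hdec _).symm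
  set H : V6 := ∑ k, (-V k) • Jc (E k) with hH
  have hsq : ∀ i, (√(G i))⁻¹ * (√(G i))⁻¹ = (G i)⁻¹ := fun i => by
    rw [← mul_inv, Real.mul_self_sqrt (hG i).le]
  have hmean : IsMeanCurvAt g q H := by
    refine ⟨(√(G 0))⁻¹ • e 0, (√(G 1))⁻¹ • e 1, (√(G 2))⁻¹ • e 2, ?_,
      _, _, _, hsff _ _, hsff _ _, hsff _ _, ?_⟩
    · have h0 : ∀ i, (√(G i))⁻¹ * ((√(G i))⁻¹ * G i) = 1 := fun i => by
        rw [← mul_assoc, hsq, inv_mul_cancel₀ (hG i).ne']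
      refine ⟨?_, ?_, ?_, ?_, ?_, ?_⟩ <;>
        simp [← hL, hE, ip6_smul_left, ip6_smul_right, hEE, h0]
    · rw [hH, ← Finset.sum_add_distrib, ← Finset.sum_add_distrib]
      refine Finset.sum_congr rfl fun k _ => ?_
      rw [← add_smul, ← add_smul, hV]
      congr 1
      simp only [map_smul, LinearMap.smul_apply, smul_smul, hsq, ip6_smul_left, ← hC,
        Fin.sum_univ_three]
      ring
  have hJH : Jc H = ∑ k, V k • E k := by
    rw [hH, Jc_sum_smul]
    simp [Jc_Jc]
  obtain ⟨hne, hmul⟩ := hM H hmean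
  refine ⟨fun h0 => hne (by simp [hH, h0]), ?_⟩
  set X : W3 := ∑ k, V k • e k with hX
  obtain ⟨c, hc⟩ := hmul X (∑ j, (ip6 (B X (e j)) H / G j) • e j) (by rw [← hL, hX, hLsum, hJH])
    (by
      rintro w n ⟨hn, v, hv⟩
      have hHv : ip6 (L v) H = 0 := by
        rw [ip6_comm]; exact hnormal _ _
      have : ip6 n H = ip6 (B X w) H := by
        rw [← hL, hB] at hv
        rw [hv, ip6_sub_left] at hHv
        linarith
      rw [this, ← hL]
      obtain ⟨d, rfl⟩ := hspan w
      rw [hLsum, hLsum]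
      simp only [ip6_sum_left, ip6_sum_right, ip6_smul_left, ip6_smul_right, map_sum, map_smul,
        hEE]
      refine Finset.sum_congr rfl fun i _ => ?_
      simp only [mul_ite, mul_zero, Finset.sum_ite_eq', Finset.mem_univ, if_true]
      field_simp [(hG i).ne'])
  refine ⟨-c, fun j => ?_⟩
  have h1 := congrArg (fun w => ip6 (L w) (E j)) hc
  simp only [map_smul, hLsum, hX] at h1
  simp only [ip6_sum_left, ip6_smul_left, hEE, mul_ite, mul_zero, Finset.sum_ite_eq',
    Finset.mem_univ, if_true] at h1
  rw [div_mul_cancel₀ _ (hG j).ne', hH] at h1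
  simp only [map_sum, map_smul, LinearMap.sum_apply, LinearMap.smul_apply, ip6_sum_left,
    ip6_sum_right, ip6_smul_left, ip6_smul_right, ← hC] at h1
  simp only [Fin.sum_univ_three] at h1 ⊢
  linear_combination -h1

section Calculus

open scoped Topology

variable {Y Z : ℝ × ℝ → E3} {p : ℝ × ℝ}

lemma ContDiffAt.fderiv_apply_const (hY : ContDiffAt ℝ (⊤ : ℕ∞) Y p) (v : ℝ × ℝ) :
    ContDiffAt ℝ (⊤ : ℕ∞) (fun q => fderiv ℝ Y q v) p :=
  (hY.fderiv_right (m := (⊤ : ℕ∞)) (by simp)).clm_apply contDiffAt_const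

lemma ContDiffAt.differentiableAt_fderiv (hY : ContDiffAt ℝ (⊤ : ℕ∞) Y p) :
    DifferentiableAt ℝ (fderiv ℝ Y) p :=
  (hY.fderiv_right (m := (⊤ : ℕ∞)) (by simp)).differentiableAt (by simp)

lemma ContDiffAt.fderiv_fderiv_apply (hY : ContDiffAt ℝ (⊤ : ℕ∞) Y p) (v w : ℝ × ℝ) :
    fderiv ℝ (fun q => fderiv ℝ Y q w) p v = fderiv ℝ (fderiv ℝ Y) p v w := by
  rw [fderiv_clm_apply hY.differentiableAt_fderiv (differentiableAt_const _)]
  simp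

lemma ContDiffAt.fderiv_fderiv_comm (hY : ContDiffAt ℝ (⊤ : ℕ∞) Y p) (v w : ℝ × ℝ) :
    fderiv ℝ (fderiv ℝ Y) p v w = fderiv ℝ (fderiv ℝ Y) p w v :=
  hY.isSymmSndFDerivAt (by simpa using (WithTop.coe_le_coe.2 (le_top : (2 : ℕ∞) ≤ ⊤))) v w

lemma inner_fderiv_add_eq_zero (hY : DifferentiableAt ℝ Y p) (hZ : DifferentiableAt ℝ Z p)
    {c : ℝ} (h : ∀ᶠ q in 𝓝 p, ⟪Y q, Z q⟫_ℝ = c) (v : ℝ × ℝ) :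
    ⟪Y p, fderiv ℝ Z p v⟫_ℝ + ⟪fderiv ℝ Y p v, Z p⟫_ℝ = 0 := by
  rw [← fderiv_inner_apply ℝ hY hZ, Filter.EventuallyEq.fderiv_eq (f := fun _ => c) h]
  simp

/-- If `Z` stays orthogonal to the image of `dY`, then `⟨dY ·, dZ ·⟩` is symmetric. -/
lemma inner_fderiv_symm (hY : ContDiffAt ℝ (⊤ : ℕ∞) Y p) (hZ : DifferentiableAt ℝ Z p)
    (h : ∀ v, ∀ᶠ q in 𝓝 p, ⟪fderiv ℝ Y q v, Z q⟫_ℝ = 0) (v w : ℝ × ℝ) :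
    ⟪fderiv ℝ Y p v, fderiv ℝ Z p w⟫_ℝ = ⟪fderiv ℝ Y p w, fderiv ℝ Z p v⟫_ℝ := by
  have key : ∀ u u', ⟪fderiv ℝ Y p u, fderiv ℝ Z p u'⟫_ℝ =
      -⟪fderiv ℝ (fderiv ℝ Y) p u' u, Z p⟫_ℝ := fun u u' => by
    have := inner_fderiv_add_eq_zero
      ((hY.fderiv_apply_const u).differentiableAt (by simp)) hZ (h u) u'
    rw [hY.fderiv_fderiv_apply] at this
    linarith
  rw [key, key, hY.fderiv_fderiv_comm]

end Calculus

/-- `v₁, v₂` is an orthonormal frame of principal directions with curvatures `a`, `b`. -/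
structure IsPrincipalFrame (x N : ℝ × ℝ → E3) (p v₁ v₂ : ℝ × ℝ) (a b : ℝ) : Prop where
  norm₁ : ⟪fderiv ℝ x p v₁, fderiv ℝ x p v₁⟫_ℝ = 1
  norm₂ : ⟪fderiv ℝ x p v₂, fderiv ℝ x p v₂⟫_ℝ = 1
  orth : ⟪fderiv ℝ x p v₁, fderiv ℝ x p v₂⟫_ℝ = 0
  deriv₁ : fderiv ℝ N p v₁ = (-a) • fderiv ℝ x p v₁
  deriv₂ : fderiv ℝ N p v₂ = (-b) • fderiv ℝ x p v₂

lemma IsPrincipalFrame.swap {x N : ℝ × ℝ → E3} {p v₁ v₂ : ℝ × ℝ} {a b : ℝ}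
    (h : IsPrincipalFrame x N p v₁ v₂ a b) : IsPrincipalFrame x N p v₂ v₁ b a :=
  ⟨h.norm₂, h.norm₁, by rw [real_inner_comm]; exact h.orth, h.deriv₂, h.deriv₁⟩

lemma eq_sum_of_orthonormal_triple {X₁ X₂ X₃ : E3} (h11 : ⟪X₁, X₁⟫_ℝ = 1) (h22 : ⟪X₂, X₂⟫_ℝ = 1)
    (h33 : ⟪X₃, X₃⟫_ℝ = 1) (h12 : ⟪X₁, X₂⟫_ℝ = 0) (h13 : ⟪X₁, X₃⟫_ℝ = 0) (h23 : ⟪X₂, X₃⟫_ℝ = 0)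
    (y : E3) : y = ⟪X₁, y⟫_ℝ • X₁ + ⟪X₂, y⟫_ℝ • X₂ + ⟪X₃, y⟫_ℝ • X₃ := by
  have hon : Orthonormal ℝ ![X₁, X₂, X₃] := by
    rw [orthonormal_iff_ite]
    intro i j
    fin_cases i <;> fin_cases j <;>
      simp [h12, h13, h23, h11, h22, h33, real_inner_comm X₁, real_inner_comm X₂,
        -inner_self_eq_norm_sq_to_K]
  have hcard : Fintype.card (Fin 3) = Module.finrank ℝ E3 := by simp
  have hb := coe_basisOfOrthonormalOfCardEqFinrank hon hcard
  have := ((basisOfOrthonormalOfCardEqFinrank hon hcard).toOrthonormalBasis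
    (by rw [hb]; exact hon)).sum_repr' y
  simpa [hb, Fin.sum_univ_three] using this.symm

namespace SurfaceData

open scoped Topology

variable {U : Set (ℝ × ℝ)} {x N : ℝ × ℝ → E3} (hS : SurfaceData U x N) {p : ℝ × ℝ} (hp : p ∈ U)
include hS hp

lemma contDiffAt_x : ContDiffAt ℝ (⊤ : ℕ∞) x p :=
  hS.smooth_x.contDiffAt (hS.open_U.mem_nhds hp)

lemma contDiffAt_N : ContDiffAt ℝ (⊤ : ℕ∞) N p :=
  hS.smooth_N.contDiffAt (hS.open_U.mem_nhds hp)

lemma differentiableAt_x : DifferentiableAt ℝ x p :=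
  (hS.contDiffAt_x hp).differentiableAt (by simp)

lemma differentiableAt_N : DifferentiableAt ℝ N p :=
  (hS.contDiffAt_N hp).differentiableAt (by simp)

lemma eventually_mem : ∀ᶠ q in 𝓝 p, q ∈ U := hS.open_U.mem_nhds hp

lemma inner_N_self : ⟪N p, N p⟫_ℝ = 1 := by
  rw [real_inner_self_eq_norm_sq, hS.unit_N p hp, one_pow]

lemma inner_fderiv_N (v : ℝ × ℝ) : ⟪N p, fderiv ℝ N p v⟫_ℝ = 0 := by
  have := inner_fderiv_add_eq_zero (hS.differentiableAt_N hp) (hS.differentiableAt_N hp)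
    ((hS.eventually_mem hp).mono fun q hq => hS.inner_N_self hq) v
  rw [real_inner_comm (N p)] at this
  linarith

lemma inner_shape_symm (v w : ℝ × ℝ) :
    ⟪fderiv ℝ x p v, fderiv ℝ N p w⟫_ℝ = ⟪fderiv ℝ x p w, fderiv ℝ N p v⟫_ℝ :=
  inner_fderiv_symm (hS.contDiffAt_x hp) (hS.differentiableAt_N hp)
    (fun v => (hS.eventually_mem hp).mono fun q hq => by
      rw [real_inner_comm]; exact hS.normal_N q hq v) v w

/-- The Codazzi equation. -/
lemma codazzi (u v w : ℝ × ℝ) :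
    ⟪fderiv ℝ x p v, fderiv ℝ (fderiv ℝ N) p w u⟫_ℝ +
        ⟪fderiv ℝ (fderiv ℝ x) p w v, fderiv ℝ N p u⟫_ℝ =
      ⟪fderiv ℝ x p u, fderiv ℝ (fderiv ℝ N) p w v⟫_ℝ +
        ⟪fderiv ℝ (fderiv ℝ x) p w u, fderiv ℝ N p v⟫_ℝ := by
  have key : ∀ u v, fderiv ℝ (fun q => ⟪fderiv ℝ x q v, fderiv ℝ N q u⟫_ℝ) p w =
      ⟪fderiv ℝ x p v, fderiv ℝ (fderiv ℝ N) p w u⟫_ℝ +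
        ⟪fderiv ℝ (fderiv ℝ x) p w v, fderiv ℝ N p u⟫_ℝ := fun u v => by
    rw [fderiv_inner_apply ℝ
      (((hS.contDiffAt_x hp).fderiv_apply_const v).differentiableAt (by simp))
      (((hS.contDiffAt_N hp).fderiv_apply_const u).differentiableAt (by simp)),
      (hS.contDiffAt_x hp).fderiv_fderiv_apply, (hS.contDiffAt_N hp).fderiv_fderiv_apply]
  rw [← key, ← key]
  congr 1
  exact Filter.EventuallyEq.fderiv_eq
    ((hS.eventually_mem hp).mono fun q hq => hS.inner_shape_symm hq v u)

lemma hasFDerivAt_nbi (t : ℝ) : HasFDerivAt (nbi x N)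
    (((fderiv ℝ x p).comp (ContinuousLinearMap.fst ℝ (ℝ × ℝ) ℝ)).prod
      (t • (fderiv ℝ N p).comp (ContinuousLinearMap.fst ℝ (ℝ × ℝ) ℝ) +
        (ContinuousLinearMap.snd ℝ (ℝ × ℝ) ℝ).smulRight (N p))) (p, t) := by
  have h1 : HasFDerivAt (fun q : W3 => q.1) (ContinuousLinearMap.fst ℝ (ℝ × ℝ) ℝ) (p, t) :=
    hasFDerivAt_fst
  have h2 : HasFDerivAt (fun q : W3 => q.2) (ContinuousLinearMap.snd ℝ (ℝ × ℝ) ℝ) (p, t) :=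
    hasFDerivAt_snd
  have hx : HasFDerivAt (fun q : W3 => x q.1) _ (p, t) :=
    HasFDerivAt.comp (p, t) (g := x) (hS.differentiableAt_x hp).hasFDerivAt h1
  have hN : HasFDerivAt (fun q : W3 => N q.1) _ (p, t) :=
    HasFDerivAt.comp (p, t) (g := N) (hS.differentiableAt_N hp).hasFDerivAt h1
  exact hx.prodMk (h2.smul hN)

lemma fderiv_nbi (t : ℝ) (w : W3) : fderiv ℝ (nbi x N) (p, t) w =
    (fderiv ℝ x p w.1, t • fderiv ℝ N p w.1 + w.2 • N p) := by
  rw [(hS.hasFDerivAt_nbi hp t).fderiv]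
  simp

lemma d2_nbi (t : ℝ) (v w : W3) : d2 (nbi x N) (p, t) v w =
    (fderiv ℝ (fderiv ℝ x) p v.1 w.1, t • fderiv ℝ (fderiv ℝ N) p v.1 w.1 +
      v.2 • fderiv ℝ N p w.1 + w.2 • fderiv ℝ N p v.1) := by
  have hev : (fun y => fderiv ℝ (nbi x N) y w) =ᶠ[𝓝 (p, t)]
      fun y => (fderiv ℝ x y.1 w.1, y.2 • fderiv ℝ N y.1 w.1 + w.2 • N y.1) :=
    (continuousAt_fst.eventually (hS.eventually_mem hp)).mono fun y hy =>
      hS.fderiv_nbi hy y.2 w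
  have h1 : HasFDerivAt (fun q : W3 => q.1) (ContinuousLinearMap.fst ℝ (ℝ × ℝ) ℝ) (p, t) :=
    hasFDerivAt_fst
  have h2 : HasFDerivAt (fun q : W3 => q.2) (ContinuousLinearMap.snd ℝ (ℝ × ℝ) ℝ) (p, t) :=
    hasFDerivAt_snd
  have hx : HasFDerivAt (fun q : W3 => fderiv ℝ x q.1 w.1) _ (p, t) :=
    HasFDerivAt.comp (p, t) (g := fun q => fderiv ℝ x q w.1)
      (((hS.contDiffAt_x hp).fderiv_apply_const w.1).differentiableAt (by simp)).hasFDerivAt h1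
  have hN : HasFDerivAt (fun q : W3 => N q.1) _ (p, t) :=
    HasFDerivAt.comp (p, t) (g := N) (hS.differentiableAt_N hp).hasFDerivAt h1
  have hN' : HasFDerivAt (fun q : W3 => fderiv ℝ N q.1 w.1) _ (p, t) :=
    HasFDerivAt.comp (p, t) (g := fun q => fderiv ℝ N q w.1)
      (((hS.contDiffAt_N hp).fderiv_apply_const w.1).differentiableAt (by simp)).hasFDerivAt h1
  rw [d2, hev.fderiv_eq]
  refine (DFunLike.congr_fun
    (hx.prodMk ((h2.smul hN').add (hN.const_smul w.2))).fderiv v).trans ?_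
  simp [(hS.contDiffAt_x hp).fderiv_fderiv_apply, (hS.contDiffAt_N hp).fderiv_fderiv_apply]

variable {v₁ v₂ : ℝ × ℝ} {a b : ℝ} (hF : IsPrincipalFrame x N p v₁ v₂ a b)
include hF

lemma eq_frame_sum (y : E3) : y = ⟪fderiv ℝ x p v₁, y⟫_ℝ • fderiv ℝ x p v₁ +
    ⟪fderiv ℝ x p v₂, y⟫_ℝ • fderiv ℝ x p v₂ + ⟪N p, y⟫_ℝ • N p :=
  eq_sum_of_orthonormal_triple hF.norm₁ hF.norm₂ (hS.inner_N_self hp) hF.orth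
    (by rw [real_inner_comm]; exact hS.normal_N p hp _)
    (by rw [real_inner_comm]; exact hS.normal_N p hp _) y

lemma eq_tangent_sum (w : ℝ × ℝ) : w = ⟪fderiv ℝ x p v₁, fderiv ℝ x p w⟫_ℝ • v₁ +
    ⟪fderiv ℝ x p v₂, fderiv ℝ x p w⟫_ℝ • v₂ := by
  apply hS.immersion p hp
  have := hS.eq_frame_sum hp hF (fderiv ℝ x p w)
  rw [hS.normal_N p hp, zero_smul, add_zero] at this
  simpa using this

end SurfaceData

/-- The components of the covariant derivative of the second fundamental form along a principal
direction `w` with curvature `κ`. -/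
def shapeDeriv (x N : ℝ × ℝ → E3) (p : ℝ × ℝ) (κ : ℝ) (u v w : ℝ × ℝ) : ℝ :=
  -(⟪fderiv ℝ (fderiv ℝ N) p u v, fderiv ℝ x p w⟫_ℝ +
    κ * ⟪fderiv ℝ (fderiv ℝ x) p u v, fderiv ℝ x p w⟫_ℝ)

namespace SurfaceData

variable {U : Set (ℝ × ℝ)} {x N : ℝ × ℝ → E3} (hS : SurfaceData U x N) {p : ℝ × ℝ} (hp : p ∈ U)
  {v₁ v₂ : ℝ × ℝ} {a b : ℝ} (hF : IsPrincipalFrame x N p v₁ v₂ a b)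
include hS hp

lemma inner_fderiv_fderiv_x (v w : ℝ × ℝ) : ⟪fderiv ℝ (fderiv ℝ x) p v w, N p⟫_ℝ =
    -⟪fderiv ℝ x p w, fderiv ℝ N p v⟫_ℝ := by
  have := inner_fderiv_add_eq_zero
    (((hS.contDiffAt_x hp).fderiv_apply_const w).differentiableAt (by simp))
    (hS.differentiableAt_N hp)
    ((hS.eventually_mem hp).mono fun q hq => by
      rw [real_inner_comm]; exact hS.normal_N q hq w) v
  rw [(hS.contDiffAt_x hp).fderiv_fderiv_apply] at this
  linarith

include hF

lemma shapeDeriv_eq : shapeDeriv x N p a v₂ v₂ v₁ = shapeDeriv x N p b v₁ v₂ v₂ := by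
  have := hS.codazzi hp v₁ v₂ v₂
  rw [hF.deriv₁, hF.deriv₂, real_inner_smul_right, real_inner_smul_right,
    (hS.contDiffAt_N hp).fderiv_fderiv_comm v₂ v₁, (hS.contDiffAt_x hp).fderiv_fderiv_comm v₂ v₁,
    real_inner_comm _ (fderiv ℝ x p v₁), real_inner_comm _ (fderiv ℝ x p v₂)] at this
  simp only [shapeDeriv]
  linear_combination this

lemma maslovian_equations (t : ℝ)
    (hM : ∀ Hq : V6, IsMeanCurvAt (nbi x N) (p, t) Hq → MaslovianAt (nbi x N) (p, t) Hq)
    {V₁ V₂ V₃ : ℝ}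
    (hV₁ : V₁ = t * (shapeDeriv x N p a v₁ v₁ v₁ / (1 + t ^ 2 * a ^ 2) +
      shapeDeriv x N p a v₂ v₂ v₁ / (1 + t ^ 2 * b ^ 2)) / (1 + t ^ 2 * a ^ 2))
    (hV₂ : V₂ = t * (shapeDeriv x N p b v₁ v₁ v₂ / (1 + t ^ 2 * a ^ 2) +
      shapeDeriv x N p b v₂ v₂ v₂ / (1 + t ^ 2 * b ^ 2)) / (1 + t ^ 2 * b ^ 2))
    (hV₃ : V₃ = a / (1 + t ^ 2 * a ^ 2) + b / (1 + t ^ 2 * b ^ 2)) :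
    ¬(V₁ = 0 ∧ V₂ = 0 ∧ V₃ = 0) ∧ ∃ c : ℝ,
      -t * (shapeDeriv x N p a v₁ v₁ v₁ * V₁ ^ 2 +
        (shapeDeriv x N p b v₁ v₁ v₂ + shapeDeriv x N p a v₂ v₁ v₁) * V₁ * V₂ +
        shapeDeriv x N p b v₂ v₁ v₂ * V₂ ^ 2) - 2 * a * V₁ * V₃ =
          c * ((1 + t ^ 2 * a ^ 2) * V₁) ∧
      -a * V₁ ^ 2 - b * V₂ ^ 2 = c * V₃ := by
  have hG₁ : 0 < 1 + t ^ 2 * a ^ 2 := by positivity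
  have hG₂ : 0 < 1 + t ^ 2 * b ^ 2 := by positivity
  let B : W3 →ₗ[ℝ] W3 →ₗ[ℝ] V6 := LinearMap.mk₂ ℝ (d2 (nbi x N) (p, t))
    (fun u v w => by
      simp only [hS.d2_nbi hp, Prod.fst_add, Prod.snd_add, map_add, add_apply,
        Prod.mk_add_mk]
      congr 1; module)
    (fun c v w => by
      simp only [hS.d2_nbi hp, Prod.smul_fst, Prod.smul_snd, map_smul,
        smul_apply, Prod.smul_mk, smul_eq_mul]
      congr 1; module)
    (fun u v w => by
      simp only [hS.d2_nbi hp, Prod.fst_add, Prod.snd_add, map_add, Prod.mk_add_mk]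
      congr 1; module)
    (fun c v w => by
      simp only [hS.d2_nbi hp, Prod.smul_fst, Prod.smul_snd, map_smul, Prod.smul_mk, smul_eq_mul]
      congr 1; module)
  have hB : ∀ v w, B v w = _ := fun v w => hS.d2_nbi hp t v w
  have hn₁ := hF.norm₁
  have hn₂ := hF.norm₂
  have h₁₂ := hF.orth
  have h₂₁ := hF.swap.orth
  have hN := hS.inner_N_self hp
  have hN₁ := hS.normal_N p hp v₁
  have hN₂ := hS.normal_N p hp v₂
  have hN₁' : ⟪fderiv ℝ x p v₁, N p⟫_ℝ = 0 := by rw [real_inner_comm]; exact hN₁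
  have hN₂' : ⟪fderiv ℝ x p v₂, N p⟫_ℝ = 0 := by rw [real_inner_comm]; exact hN₂
  have hexp := hS.eq_frame_sum hp hF
  have hd₁ := hF.deriv₁
  have hd₂ := hF.deriv₂
  have hxN := hS.inner_fderiv_fderiv_x hp
  set X₁ := fderiv ℝ x p v₁ with hX₁
  set X₂ := fderiv ℝ x p v₂ with hX₂
  set e : Fin 3 → W3 := ![(v₁, 0), (v₂, 0), (0, 1)] with he
  set E : Fin 3 → V6 := ![(X₁, -(t * a) • X₁), (X₂, -(t * b) • X₂), (0, N p)] with hE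
  set G : Fin 3 → ℝ := ![1 + t ^ 2 * a ^ 2, 1 + t ^ 2 * b ^ 2, 1] with hG
  obtain ⟨hne, c, hc⟩ := MaslovianAt.exists_eigenvalue (g := nbi x N) (q := (p, t)) (B := B)
    (e := e) (E := E) (G := G) (C := fun i j k => ip6 (B (e i) (e j)) (Jc (E k)))
    (V := ![V₁, V₂, V₃]) (fun v w => rfl)
    (by
      intro i
      fin_cases i <;> simp [he, hE, hS.fderiv_nbi hp, hd₁, hd₂, ← hX₁, ← hX₂, smul_smul])
    (by
      intro w
      refine ⟨![⟪X₁, fderiv ℝ x p w.1⟫_ℝ, ⟪X₂, fderiv ℝ x p w.1⟫_ℝ, w.2], ?_⟩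
      have := hS.eq_tangent_sum hp hF w.1
      refine Prod.ext ?_ ?_
      · simpa [he, Fin.sum_univ_three] using this
      · simp [he, Fin.sum_univ_three])
    (by
      intro i
      fin_cases i <;> simp [hG, hG₁, hG₂])
    (by
      intro i j
      fin_cases i <;> fin_cases j <;>
        simp [hE, hG, ip6, real_inner_smul_left, real_inner_smul_right, hn₁, hn₂, h₁₂, h₂₁, hN,
          hN₁, hN₂, hN₁', hN₂', -inner_self_eq_norm_sq_to_K] <;> ring)
    (by
      intro i j
      fin_cases i <;> fin_cases j <;>
        simp [hE, Jc, ip6, real_inner_smul_left, real_inner_smul_right, hn₁, hn₂, h₁₂, h₂₁,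
          hN₁, hN₂, hN₁', hN₂', -inner_self_eq_norm_sq_to_K])
    (by
      rintro ⟨y, z⟩
      have hy := hexp y
      have hz := hexp z
      simp only [hE, hG, Jc, ip6, Fin.sum_univ_three]
      simp only [Matrix.cons_val, inner_neg_right, real_inner_smul_right, inner_zero_right,
        real_inner_comm X₁ y, real_inner_comm X₁ z, real_inner_comm X₂ y, real_inner_comm X₂ z,
        real_inner_comm (N p) y, real_inner_comm (N p) z]
      generalize ⟪X₁, y⟫_ℝ = y₁, ⟪X₂, y⟫_ℝ = y₂, ⟪N p, y⟫_ℝ = y₃, ⟪X₁, z⟫_ℝ = z₁,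
        ⟪X₂, z⟫_ℝ = z₂, ⟪N p, z⟫_ℝ = z₃ at hy hz ⊢
      subst hy hz
      refine Prod.ext ?_ ?_ <;>
      · simp only [Prod.smul_mk, Prod.mk_add_mk]
        match_scalars <;> field_simp <;> ring)
    (fun i j k => rfl)
    (by
      intro k
      fin_cases k <;>
      simp [hB, he, hE, hG, Fin.sum_univ_three, Jc, ip6, real_inner_smul_left,
        inner_add_left, hn₁, hn₂, hd₁, hd₂, hxN, real_inner_smul_right,
        ← hX₁, ← hX₂, hV₁, hV₂, hV₃, shapeDeriv, -inner_self_eq_norm_sq_to_K] <;>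
      field_simp <;> ring)
    hM
  refine ⟨fun ⟨h1, h2, h3⟩ => hne (by simp [h1, h2, h3]), c, ?_, ?_⟩
  · have h0 := hc 0
    simp only [hB, he, hE, hG, Fin.sum_univ_three, Jc, ip6, Matrix.cons_val, hxN, hd₁, hd₂,
      real_inner_smul_left, real_inner_smul_right, inner_add_left, inner_neg_right, hn₁, h₁₂,
      h₂₁, ← hX₁, map_zero, zero_apply, inner_zero_left, inner_zero_right] at h0
    simp only [shapeDeriv, ← hX₁, ← hX₂]
    linear_combination h0
  · have h2 := hc 2
    simp only [hB, he, hE, hG, Fin.sum_univ_three, Jc, ip6, Matrix.cons_val, hd₁, hd₂,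
      real_inner_smul_left, inner_add_left, inner_neg_right, hn₁, hn₂, h₁₂,
      h₂₁, map_zero, inner_zero_left, inner_zero_right] at h2
    linear_combination h2

end SurfaceData

lemma eq_zero_at_zero_of_eigenvalue {Z₁ Z₂ W g : ℝ → ℝ} (hZ₁ : Continuous Z₁) (hZ₂ : Continuous Z₂)
    (hW : Continuous W) (hg : Continuous g) {a b q₁ q₂ q₃ : ℝ} (ha : a ≠ 0) (hW0 : W 0 ≠ 0) (n : ℕ)
    (h : ∀ t : ℝ, ∃ c : ℝ,
      -t * (q₁ * (t ^ (n + 1) * Z₁ t) ^ 2 + q₂ * (t ^ (n + 1) * Z₁ t) * (t ^ (n + 1) * Z₂ t) +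
        q₃ * (t ^ (n + 1) * Z₂ t) ^ 2) - 2 * a * (t ^ (n + 1) * Z₁ t) * W t =
          c * (g t * (t ^ (n + 1) * Z₁ t)) ∧
      -a * (t ^ (n + 1) * Z₁ t) ^ 2 - b * (t ^ (n + 1) * Z₂ t) ^ 2 = c * W t) :
    Z₁ 0 = 0 := by
  have hF : (fun t : ℝ => W t * (-t * t ^ (n + 1) * (q₁ * Z₁ t ^ 2 + q₂ * Z₁ t * Z₂ t +
      q₃ * Z₂ t ^ 2) - 2 * a * Z₁ t * W t)) =
      fun t => g t * Z₁ t * (t ^ (n + 1)) ^ 2 * (-a * Z₁ t ^ 2 - b * Z₂ t ^ 2) := by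
    refine Continuous.ext_on (dense_compl_singleton (0 : ℝ)) (by fun_prop) (by fun_prop)
      fun t ht => ?_
    obtain ⟨c, h1, h2⟩ := h t
    have ht' : t ^ (n + 1) ≠ 0 := pow_ne_zero _ ht
    apply mul_left_cancel₀ ht'
    linear_combination W t * h1 - g t * (t ^ (n + 1) * Z₁ t) * h2
  have h0 := congrFun hF 0
  have : a * (W 0) ^ 2 * Z₁ 0 = 0 := by
    simp only [zero_pow n.succ_ne_zero] at h0
    linear_combination -h0 / 2
  simpa [ha, hW0] using this

namespace SurfaceData

variable {U : Set (ℝ × ℝ)} {x N : ℝ × ℝ → E3} (hS : SurfaceData U x N) {p : ℝ × ℝ} (hp : p ∈ U)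
  {v₁ v₂ : ℝ × ℝ} {a b : ℝ} (hF : IsPrincipalFrame x N p v₁ v₂ a b)
  (hM : ∀ t : ℝ, ∀ Hq : V6,
    IsMeanCurvAt (nbi x N) (p, t) Hq → MaslovianAt (nbi x N) (p, t) Hq)
include hS hp hF hM

lemma add_ne_zero_of_maslovian : a + b ≠ 0 := by
  intro h
  refine (hS.maslovian_equations hp hF 0 (hM 0) rfl rfl rfl).1 ⟨by simp, by simp, by simpa⟩

lemma eq_zero_of_maslovian (ha : a ≠ 0) {Z₁ Z₂ : ℝ → ℝ} (hZ₁ : Continuous Z₁)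
    (hZ₂ : Continuous Z₂) (n : ℕ)
    (hV₁ : ∀ t, t ^ (n + 1) * Z₁ t = t * (shapeDeriv x N p a v₁ v₁ v₁ / (1 + t ^ 2 * a ^ 2) +
      shapeDeriv x N p a v₂ v₂ v₁ / (1 + t ^ 2 * b ^ 2)) / (1 + t ^ 2 * a ^ 2))
    (hV₂ : ∀ t, t ^ (n + 1) * Z₂ t = t * (shapeDeriv x N p b v₁ v₁ v₂ / (1 + t ^ 2 * a ^ 2) +
      shapeDeriv x N p b v₂ v₂ v₂ / (1 + t ^ 2 * b ^ 2)) / (1 + t ^ 2 * b ^ 2)) :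
    Z₁ 0 = 0 := by
  have hab := hS.add_ne_zero_of_maslovian hp hF hM
  have h₁ : ∀ t : ℝ, 1 + t ^ 2 * a ^ 2 ≠ 0 := fun t => by positivity
  have h₂ : ∀ t : ℝ, 1 + t ^ 2 * b ^ 2 ≠ 0 := fun t => by positivity
  exact eq_zero_at_zero_of_eigenvalue hZ₁ hZ₂
    (W := fun t => a / (1 + t ^ 2 * a ^ 2) + b / (1 + t ^ 2 * b ^ 2))
    (g := fun t => 1 + t ^ 2 * a ^ 2) (by fun_prop (disch := simp [h₁, h₂])) (by fun_prop) ha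
    (by simpa using hab) n
    fun t => (hS.maslovian_equations hp hF t (hM t) (hV₁ t) (hV₂ t) rfl).2

lemma shapeDeriv_add_eq_zero (ha : a ≠ 0) :
    shapeDeriv x N p a v₁ v₁ v₁ + shapeDeriv x N p b v₁ v₂ v₂ = 0 := by
  have h₁ : ∀ t : ℝ, 1 + t ^ 2 * a ^ 2 ≠ 0 := fun t => by positivity
  have h₂ : ∀ t : ℝ, 1 + t ^ 2 * b ^ 2 ≠ 0 := fun t => by positivity
  have := hS.eq_zero_of_maslovian hp hF hM ha
    (Z₁ := fun t => (shapeDeriv x N p a v₁ v₁ v₁ / (1 + t ^ 2 * a ^ 2) +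
      shapeDeriv x N p a v₂ v₂ v₁ / (1 + t ^ 2 * b ^ 2)) / (1 + t ^ 2 * a ^ 2))
    (Z₂ := fun t => (shapeDeriv x N p b v₁ v₁ v₂ / (1 + t ^ 2 * a ^ 2) +
      shapeDeriv x N p b v₂ v₂ v₂ / (1 + t ^ 2 * b ^ 2)) / (1 + t ^ 2 * b ^ 2))
    (by fun_prop (disch := simp [h₁, h₂])) (by fun_prop (disch := simp [h₁, h₂])) 0
    (fun t => by ring) (fun t => by ring)
  rw [← hS.shapeDeriv_eq hp hF]
  simpa using this

lemma sub_mul_shapeDeriv_eq_zero (ha : a ≠ 0) (hb : b ≠ 0) :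
    (b - a) * shapeDeriv x N p a v₁ v₁ v₁ = 0 := by
  have h₁ : ∀ t : ℝ, 1 + t ^ 2 * a ^ 2 ≠ 0 := fun t => by positivity
  have h₂ : ∀ t : ℝ, 1 + t ^ 2 * b ^ 2 ≠ 0 := fun t => by positivity
  have hm₁ := hS.shapeDeriv_add_eq_zero hp hF hM ha
  have hm₂ := hS.shapeDeriv_add_eq_zero hp hF.swap hM hb
  rw [← hS.shapeDeriv_eq hp hF] at hm₁
  rw [← hS.shapeDeriv_eq hp hF.swap] at hm₂
  have := hS.eq_zero_of_maslovian hp hF hM ha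
    (Z₁ := fun t => shapeDeriv x N p a v₁ v₁ v₁ * (b ^ 2 - a ^ 2) /
      ((1 + t ^ 2 * a ^ 2) ^ 2 * (1 + t ^ 2 * b ^ 2)))
    (Z₂ := fun t => shapeDeriv x N p b v₂ v₂ v₂ * (a ^ 2 - b ^ 2) /
      ((1 + t ^ 2 * b ^ 2) ^ 2 * (1 + t ^ 2 * a ^ 2)))
    (by fun_prop (disch := simp [h₁, h₂])) (by fun_prop (disch := simp [h₁, h₂])) 2
    (fun t => by
      rw [eq_neg_of_add_eq_zero_right hm₁]
      have := h₁ t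
      have := h₂ t
      field_simp
      ring)
    (fun t => by
      rw [eq_neg_of_add_eq_zero_right hm₂]
      have := h₁ t
      have := h₂ t
      field_simp
      ring)
  have hab := hS.add_ne_zero_of_maslovian hp hF hM
  apply mul_left_cancel₀ hab
  simp only [ne_eq, OfNat.ofNat_ne_zero, not_false_eq_true, zero_pow, zero_mul, add_zero, one_pow,
    mul_one, div_one] at this
  linear_combination this

end SurfaceData

lemma hasFDerivAt_of_mul_eventuallyEq {m D n : ℝ × ℝ → ℝ} {p : ℝ × ℝ} {D' n' : ℝ × ℝ →L[ℝ] ℝ}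
    (hD : HasFDerivAt D D' p) (hn : HasFDerivAt n n' p) (hDp : D p = 1)
    (h : ∀ᶠ q in nhds p, m q * D q = n q) : HasFDerivAt m (n' - m p • D') p := by
  have hne : ∀ᶠ q in nhds p, D q ≠ 0 :=
    hD.continuousAt.eventually_ne (by rw [hDp]; exact one_ne_zero)
  have hm : m =ᶠ[nhds p] fun q => n q * (D q)⁻¹ := by
    filter_upwards [h, hne] with q h1 h2
    rw [← h1, mul_inv_cancel_right₀ h2]
  have hmd : DifferentiableAt ℝ m p :=
    (hn.differentiableAt.fun_mul (hD.differentiableAt.fun_inv hne.self_of_nhds)).congr_of_eventuallyEq hm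
  have hmul := (hmd.hasFDerivAt.mul hD).unique (hn.congr_of_eventuallyEq h)
  rw [hDp, one_smul] at hmul
  rw [← hmul, add_sub_cancel_left]
  exact hmd.hasFDerivAt

namespace SurfaceData

variable {U : Set (ℝ × ℝ)} {x N : ℝ × ℝ → E3} (hS : SurfaceData U x N) {p : ℝ × ℝ} (hp : p ∈ U)
include hS hp

lemma gram_identities {w₁ w₂ : ℝ × ℝ} {a b : ℝ} (hF : IsPrincipalFrame x N p w₁ w₂ a b)
    (u v : ℝ × ℝ) :
    (a + b) * (⟪fderiv ℝ x p u, fderiv ℝ x p u⟫_ℝ * ⟪fderiv ℝ x p v, fderiv ℝ x p v⟫_ℝ -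
        ⟪fderiv ℝ x p u, fderiv ℝ x p v⟫_ℝ * ⟪fderiv ℝ x p u, fderiv ℝ x p v⟫_ℝ) =
      2 * (⟪fderiv ℝ x p u, fderiv ℝ x p v⟫_ℝ * ⟪fderiv ℝ N p u, fderiv ℝ x p v⟫_ℝ) -
        ⟪fderiv ℝ x p v, fderiv ℝ x p v⟫_ℝ * ⟪fderiv ℝ N p u, fderiv ℝ x p u⟫_ℝ -
        ⟪fderiv ℝ x p u, fderiv ℝ x p u⟫_ℝ * ⟪fderiv ℝ N p v, fderiv ℝ x p v⟫_ℝ ∧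
    a * b * (⟪fderiv ℝ x p u, fderiv ℝ x p u⟫_ℝ * ⟪fderiv ℝ x p v, fderiv ℝ x p v⟫_ℝ -
        ⟪fderiv ℝ x p u, fderiv ℝ x p v⟫_ℝ * ⟪fderiv ℝ x p u, fderiv ℝ x p v⟫_ℝ) =
      ⟪fderiv ℝ N p u, fderiv ℝ x p u⟫_ℝ * ⟪fderiv ℝ N p v, fderiv ℝ x p v⟫_ℝ -
        ⟪fderiv ℝ N p u, fderiv ℝ x p v⟫_ℝ * ⟪fderiv ℝ N p u, fderiv ℝ x p v⟫_ℝ := by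
  have hu := hS.eq_tangent_sum hp hF u
  have hv := hS.eq_tangent_sum hp hF v
  generalize ⟪fderiv ℝ x p w₁, fderiv ℝ x p u⟫_ℝ = u₁,
    ⟪fderiv ℝ x p w₂, fderiv ℝ x p u⟫_ℝ = u₂ at hu
  generalize ⟪fderiv ℝ x p w₁, fderiv ℝ x p v⟫_ℝ = v₁,
    ⟪fderiv ℝ x p w₂, fderiv ℝ x p v⟫_ℝ = v₂ at hv
  subst hu hv
  simp only [map_add, map_smul, hF.deriv₁, hF.deriv₂, inner_add_left, inner_add_right,
    real_inner_smul_left, real_inner_smul_right, hF.norm₁, hF.norm₂, hF.orth, hF.swap.orth]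
  constructor <;> ring

variable {v₁ v₂ : ℝ × ℝ} {a b : ℝ × ℝ → ℝ} (hF : IsPrincipalFrame x N p v₁ v₂ (a p) (b p))
  (hprin : ∀ q ∈ U, ∃ w₁ w₂, IsPrincipalFrame x N q w₁ w₂ (a q) (b q))
include hF hprin

lemma differentiableAt_curvatures :
    (DifferentiableAt ℝ (fun q => a q + b q) p ∧ ∀ w, fderiv ℝ (fun q => a q + b q) p w =
      shapeDeriv x N p (a p) w v₁ v₁ + shapeDeriv x N p (b p) w v₂ v₂) ∧
    (DifferentiableAt ℝ (fun q => a q * b q) p ∧ ∀ w, fderiv ℝ (fun q => a q * b q) p w =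
      b p * shapeDeriv x N p (a p) w v₁ v₁ + a p * shapeDeriv x N p (b p) w v₂ v₂) := by
  have hx := fun v => (((hS.contDiffAt_x hp).fderiv_apply_const v).differentiableAt
    (by simp)).hasFDerivAt
  have hN := fun v => (((hS.contDiffAt_N hp).fderiv_apply_const v).differentiableAt
    (by simp)).hasFDerivAt
  have hG := fun u v => (hx u).inner ℝ (hx v)
  have hh := fun u v => (hN u).inner ℝ (hx v)
  have hdet := ((hG v₁ v₁).mul (hG v₂ v₂)).sub ((hG v₁ v₂).mul (hG v₁ v₂))
  have hsum := ((((hG v₁ v₂).mul (hh v₁ v₂)).const_mul 2).sub ((hG v₂ v₂).mul (hh v₁ v₁))).sub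
    ((hG v₁ v₁).mul (hh v₂ v₂))
  have hprod := ((hh v₁ v₁).mul (hh v₂ v₂)).sub ((hh v₁ v₂).mul (hh v₁ v₂))
  have hm := hasFDerivAt_of_mul_eventuallyEq (m := fun q => a q + b q) hdet hsum
    (by simp [hF.norm₁, hF.norm₂, hF.orth, -inner_self_eq_norm_sq_to_K])
    ((hS.eventually_mem hp).mono fun q hq => by
      obtain ⟨w₁, w₂, hw⟩ := hprin q hq
      exact (hS.gram_identities hq hw v₁ v₂).1)
  have hK := hasFDerivAt_of_mul_eventuallyEq (m := fun q => a q * b q) hdet hprod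
    (by simp [hF.norm₁, hF.norm₂, hF.orth, -inner_self_eq_norm_sq_to_K])
    ((hS.eventually_mem hp).mono fun q hq => by
      obtain ⟨w₁, w₂, hw⟩ := hprin q hq
      exact (hS.gram_identities hq hw v₁ v₂).2)
  have hcomm := fun w v u => real_inner_comm (fderiv ℝ (fderiv ℝ x) p w v) (fderiv ℝ x p u)
  refine ⟨⟨hm.differentiableAt, fun w => ?_⟩, ⟨hK.differentiableAt, fun w => ?_⟩⟩
  · rw [hm.fderiv]
    simp [(hS.contDiffAt_x hp).fderiv_fderiv_apply, (hS.contDiffAt_N hp).fderiv_fderiv_apply,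
      fderivInnerCLM_apply, hF.deriv₁, hF.deriv₂, real_inner_smul_left, hF.norm₁, hF.norm₂,
      hF.orth, shapeDeriv, -inner_self_eq_norm_sq_to_K, hcomm]
    ring
  · rw [hK.fderiv]
    simp [(hS.contDiffAt_x hp).fderiv_fderiv_apply, (hS.contDiffAt_N hp).fderiv_fderiv_apply,
      fderivInnerCLM_apply, hF.deriv₁, hF.deriv₂, real_inner_smul_left, hF.norm₁, hF.norm₂,
      hF.orth, shapeDeriv, -inner_self_eq_norm_sq_to_K, hcomm]
    ring

end SurfaceData

lemma inner_sndFDeriv_symm {Y Z : ℝ × ℝ → E3} {p : ℝ × ℝ} (hY : ContDiffAt ℝ (⊤ : ℕ∞) Y p)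
    (hZ : ContDiffAt ℝ (⊤ : ℕ∞) Z p)
    (h : ∀ u v, ∀ᶠ q in nhds p, ⟪fderiv ℝ Y q u, fderiv ℝ Z q v⟫_ℝ = 0) (k i j : ℝ × ℝ) :
    ⟪fderiv ℝ (fderiv ℝ Y) p k i, fderiv ℝ Z p j⟫_ℝ =
      ⟪fderiv ℝ (fderiv ℝ Y) p j i, fderiv ℝ Z p k⟫_ℝ := by
  have key : ∀ k j, ⟪fderiv ℝ (fderiv ℝ Y) p k i, fderiv ℝ Z p j⟫_ℝ =
      -⟪fderiv ℝ Y p i, fderiv ℝ (fderiv ℝ Z) p k j⟫_ℝ := fun k j => by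
    have := inner_fderiv_add_eq_zero ((hY.fderiv_apply_const i).differentiableAt (by simp))
      ((hZ.fderiv_apply_const j).differentiableAt (by simp)) (h i j) k
    rw [hY.fderiv_fderiv_apply, hZ.fderiv_fderiv_apply] at this
    linarith
  rw [key, key, hZ.fderiv_fderiv_comm]

namespace SurfaceData

open scoped Topology

variable {U : Set (ℝ × ℝ)} {x N : ℝ × ℝ → E3} (hS : SurfaceData U x N) {p : ℝ × ℝ} (hp : p ∈ U)
include hS hp

lemma contDiffAt_parallel (c : ℝ) : ContDiffAt ℝ (⊤ : ℕ∞) (fun q => N q + c • x q) p :=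
  (hS.contDiffAt_N hp).add ((hS.contDiffAt_x hp).const_smul c)

lemma fderiv_parallel (c : ℝ) (u : ℝ × ℝ) :
    fderiv ℝ (fun q => N q + c • x q) p u = fderiv ℝ N p u + c • fderiv ℝ x p u := by
  rw [((hS.differentiableAt_N hp).hasFDerivAt.fun_add
    ((hS.differentiableAt_x hp).hasFDerivAt.fun_const_smul c)).fderiv]
  simp

lemma inner_fderiv_parallel_eq_zero {v₁ v₂ : ℝ × ℝ} {a b : ℝ}
    (hF : IsPrincipalFrame x N p v₁ v₂ a b) (u v : ℝ × ℝ) :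
    ⟪fderiv ℝ (fun q => N q + b • x q) p u, fderiv ℝ (fun q => N q + a • x q) p v⟫_ℝ = 0 := by
  rw [hS.fderiv_parallel hp, hS.fderiv_parallel hp]
  have hu := hS.eq_tangent_sum hp hF u
  have hv := hS.eq_tangent_sum hp hF v
  generalize ⟪fderiv ℝ x p v₁, fderiv ℝ x p u⟫_ℝ = u₁,
    ⟪fderiv ℝ x p v₂, fderiv ℝ x p u⟫_ℝ = u₂ at hu
  generalize ⟪fderiv ℝ x p v₁, fderiv ℝ x p v⟫_ℝ = w₁,
    ⟪fderiv ℝ x p v₂, fderiv ℝ x p v⟫_ℝ = w₂ at hv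
  subst hu hv
  simp only [map_add, map_smul, hF.deriv₁, hF.deriv₂, inner_add_left, inner_add_right,
    real_inner_smul_left, real_inner_smul_right, hF.norm₁, hF.norm₂, hF.orth, hF.swap.orth]
  ring

lemma inner_sndFDeriv_parallel_normal (c : ℝ) (k i : ℝ × ℝ) :
    ⟪fderiv ℝ (fderiv ℝ fun q => N q + c • x q) p k i, N p⟫_ℝ =
      -⟪fderiv ℝ N p i + c • fderiv ℝ x p i, fderiv ℝ N p k⟫_ℝ := by
  have hy := hS.contDiffAt_parallel hp c
  have := inner_fderiv_add_eq_zero ((hy.fderiv_apply_const i).differentiableAt (by simp))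
    (hS.differentiableAt_N hp) (c := 0) ((hS.eventually_mem hp).mono fun q hq => by
      rw [hS.fderiv_parallel hq, real_inner_comm, inner_add_right, real_inner_smul_right,
        hS.inner_fderiv_N hq, hS.normal_N q hq, mul_zero, add_zero]) k
  rw [hy.fderiv_fderiv_apply, hS.fderiv_parallel hp] at this
  linarith

variable {a b : ℝ} (hprin : ∀ q ∈ U, ∃ w₁ w₂, IsPrincipalFrame x N q w₁ w₂ a b)
include hprin

lemma inner_sndFDeriv_parallel_eq_zero (k i j : ℝ × ℝ) :
    ⟪fderiv ℝ (fderiv ℝ fun q => N q + b • x q) p k i,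
      fderiv ℝ (fun q => N q + a • x q) p j⟫_ℝ = 0 := by
  obtain ⟨v₁, v₂, hF⟩ := hprin p hp
  have hy := hS.contDiffAt_parallel hp b
  have hz := hS.contDiffAt_parallel hp a
  have hperp : ∀ u v, ∀ᶠ q in 𝓝 p, ⟪fderiv ℝ (fun q => N q + b • x q) q u,
      fderiv ℝ (fun q => N q + a • x q) q v⟫_ℝ = 0 := fun u v =>
    (hS.eventually_mem hp).mono fun q hq => by
      obtain ⟨w₁, w₂, hw⟩ := hprin q hq
      exact hS.inner_fderiv_parallel_eq_zero hq hw u v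
  have hz1 : fderiv ℝ (fun q => N q + a • x q) p v₁ = 0 := by
    rw [hS.fderiv_parallel hp, hF.deriv₁, ← add_smul]; simp
  have hy2 : fderiv ℝ (fun q => N q + b • x q) p v₂ = 0 := by
    rw [hS.fderiv_parallel hp, hF.deriv₂, ← add_smul]; simp
  have hB2 : ∀ k j, ⟪fderiv ℝ (fderiv ℝ fun q => N q + b • x q) p k v₂,
      fderiv ℝ (fun q => N q + a • x q) p j⟫_ℝ = 0 := fun k j => by
    have := inner_fderiv_add_eq_zero ((hy.fderiv_apply_const v₂).differentiableAt (by simp))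
      ((hz.fderiv_apply_const j).differentiableAt (by simp)) (hperp v₂ j) k
    rwa [hy.fderiv_fderiv_apply, hy2, inner_zero_left, zero_add] at this
  have hB1 : ∀ k i, ⟪fderiv ℝ (fderiv ℝ fun q => N q + b • x q) p k i,
      fderiv ℝ (fun q => N q + a • x q) p v₂⟫_ℝ = 0 := fun k i => by
    rw [inner_sndFDeriv_symm hy hz hperp, hy.fderiv_fderiv_comm, hB2]
  rw [hS.eq_tangent_sum hp hF j, map_add, map_smul, map_smul, hz1, smul_zero, zero_add,
    real_inner_smul_right, hB1, mul_zero]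

/-- The only surfaces with two constant nonzero principal curvatures are totally umbilical. -/
lemma eq_of_constant_curvatures (ha : a ≠ 0) (hb : b ≠ 0) : a = b := by
  by_contra hab
  obtain ⟨v₁, v₂, hF⟩ := hprin p hp
  have hy := hS.contDiffAt_parallel hp b
  have hz := hS.contDiffAt_parallel hp a
  have hyz := hS.inner_sndFDeriv_parallel_eq_zero hp hprin
  have hzy := hS.inner_sndFDeriv_parallel_eq_zero hp fun q hq =>
    let ⟨w₁, w₂, hw⟩ := hprin q hq; ⟨w₂, w₁, hw.swap⟩
  have hgauss := inner_fderiv_symm (hy.fderiv_apply_const v₁)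
    ((hz.fderiv_apply_const v₂).differentiableAt (by simp))
    (fun k => (hS.eventually_mem hp).mono fun q hq => by
      rw [(hS.contDiffAt_parallel hq b).fderiv_fderiv_apply]
      exact hS.inner_sndFDeriv_parallel_eq_zero hq hprin k v₁ v₂) v₁ v₂
  have hy2 : ∀ k i, ⟪fderiv ℝ (fderiv ℝ fun q => N q + b • x q) p k i,
      fderiv ℝ x p v₂⟫_ℝ = 0 := fun k i => by
    have := hyz k i v₂
    rw [hS.fderiv_parallel hp, hF.deriv₂, ← add_smul, real_inner_smul_right] at this
    exact (mul_eq_zero.1 this).resolve_left fun h => hab (by linarith)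
  have hz1 : ∀ k i, ⟪fderiv ℝ x p v₁,
      fderiv ℝ (fderiv ℝ fun q => N q + a • x q) p k i⟫_ℝ = 0 := fun k i => by
    have := hzy k i v₁
    rw [hS.fderiv_parallel hp, hF.deriv₁, ← add_smul, real_inner_smul_right] at this
    rw [real_inner_comm]
    exact (mul_eq_zero.1 this).resolve_left fun h => hab (by linarith)
  have hinner : ∀ k i l j, ⟪fderiv ℝ (fderiv ℝ fun q => N q + b • x q) p k i,
      fderiv ℝ (fderiv ℝ fun q => N q + a • x q) p l j⟫_ℝ =
      ⟪fderiv ℝ N p j + a • fderiv ℝ x p j, fderiv ℝ N p l⟫_ℝ *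
        ⟪fderiv ℝ N p i + b • fderiv ℝ x p i, fderiv ℝ N p k⟫_ℝ := fun k i l j => by
    conv_lhs => rw [hS.eq_frame_sum hp hF (fderiv ℝ (fderiv ℝ fun q => N q + a • x q) p l j)]
    rw [hz1, inner_add_right, inner_add_right, real_inner_smul_right, real_inner_smul_right,
      real_inner_smul_right, hy2, real_inner_comm _ (N p), hS.inner_sndFDeriv_parallel_normal hp,
      hS.inner_sndFDeriv_parallel_normal hp]
    ring
  rw [hy.fderiv_fderiv_apply, hy.fderiv_fderiv_apply, hz.fderiv_fderiv_apply,
    hz.fderiv_fderiv_apply, hinner, hinner] at hgauss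
  simp only [hF.deriv₁, hF.deriv₂, inner_add_left, real_inner_smul_left, real_inner_smul_right,
    hF.norm₁, hF.norm₂, hF.orth, hF.swap.orth] at hgauss
  have : a * b * (a - b) ^ 2 = 0 := by linear_combination -hgauss
  exact mul_ne_zero (mul_ne_zero ha hb) (pow_ne_zero 2 (sub_ne_zero.2 hab)) this

end SurfaceData

/-- If both principal curvatures of a surface are nowhere zero and the
normal bundle immersion is a Maslovian Lagrangian immersion, then the principal curvatures
are constant. -/
theorem maslovian_nonzero_curvatures_constant (U : Set (ℝ × ℝ)) (x N : ℝ × ℝ → E3)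
    (hS : SurfaceData U x N) (a b : ℝ × ℝ → ℝ)
    (hprin : ∀ p ∈ U, ∃ v₁ v₂ : ℝ × ℝ,
      ⟪fderiv ℝ x p v₁, fderiv ℝ x p v₁⟫_ℝ = 1 ∧
      ⟪fderiv ℝ x p v₂, fderiv ℝ x p v₂⟫_ℝ = 1 ∧
      ⟪fderiv ℝ x p v₁, fderiv ℝ x p v₂⟫_ℝ = 0 ∧
      fderiv ℝ N p v₁ = (-(a p)) • fderiv ℝ x p v₁ ∧
      fderiv ℝ N p v₂ = (-(b p)) • fderiv ℝ x p v₂)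
    (ha : ∀ p ∈ U, a p ≠ 0) (hb : ∀ p ∈ U, b p ≠ 0)
    (hmas : ∀ q : W3, q.1 ∈ U → LagrangianAt (nbi x N) q ∧
      ∀ Hq : V6, IsMeanCurvAt (nbi x N) q Hq → MaslovianAt (nbi x N) q Hq) :
    ∃ ca cb : ℝ, ∀ p ∈ U, a p = ca ∧ b p = cb := by
  have hframe : ∀ p ∈ U, ∃ v₁ v₂, IsPrincipalFrame x N p v₁ v₂ (a p) (b p) := fun p hp =>
    let ⟨v₁, v₂, h1, h2, h3, h4, h5⟩ := hprin p hp; ⟨v₁, v₂, h1, h2, h3, h4, h5⟩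
  have hderiv : ∀ p ∈ U,
      (DifferentiableAt ℝ (fun q => a q + b q) p ∧ fderiv ℝ (fun q => a q + b q) p = 0) ∧
      (DifferentiableAt ℝ (fun q => a q * b q) p ∧ fderiv ℝ (fun q => a q * b q) p = 0) := by
    intro p hp
    obtain ⟨v₁, v₂, hF⟩ := hframe p hp
    have hM : ∀ t Hq, IsMeanCurvAt (nbi x N) (p, t) Hq → MaslovianAt (nbi x N) (p, t) Hq :=
      fun t => (hmas (p, t) hp).2
    obtain ⟨⟨hs, hs'⟩, ⟨hm, hm'⟩⟩ := hS.differentiableAt_curvatures hp hF hframe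
    have h1 := hS.shapeDeriv_add_eq_zero hp hF hM (ha p hp)
    have h2 := hS.sub_mul_shapeDeriv_eq_zero hp hF hM (ha p hp) (hb p hp)
    have h3 := hS.shapeDeriv_add_eq_zero hp hF.swap hM (hb p hp)
    have h4 := hS.sub_mul_shapeDeriv_eq_zero hp hF.swap hM (hb p hp) (ha p hp)
    have hzero : ∀ L : ℝ × ℝ →L[ℝ] ℝ, L v₁ = 0 → L v₂ = 0 → L = 0 := fun L hL₁ hL₂ => by
      refine ContinuousLinearMap.ext fun w => ?_
      rw [hS.eq_tangent_sum hp hF w]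
      simp [hL₁, hL₂]
    exact ⟨⟨hs, hzero _ (by rw [hs']; linarith) (by rw [hs']; linarith)⟩, hm,
      hzero _ (by rw [hm']; linear_combination h2 + a p * h1)
        (by rw [hm']; linear_combination h4 + b p * h3)⟩
  obtain ⟨s, hs⟩ := hS.open_U.exists_is_const_of_fderiv_eq_zero hS.conn_U.isPreconnected
    (fun p hp => (hderiv p hp).1.1.differentiableWithinAt) fun p hp => (hderiv p hp).1.2
  obtain ⟨m, hm⟩ := hS.open_U.exists_is_const_of_fderiv_eq_zero hS.conn_U.isPreconnected
    (fun p hp => (hderiv p hp).2.1.differentiableWithinAt) fun p hp => (hderiv p hp).2.2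
  obtain ⟨p₀, hp₀⟩ := hS.conn_U.nonempty
  have hcases : ∀ p ∈ U, (a p = a p₀ ∧ b p = b p₀) ∨ (a p = b p₀ ∧ b p = a p₀) := fun p hp => by
    have hsum : a p + b p = a p₀ + b p₀ := (hs p hp).trans (hs p₀ hp₀).symm
    have hprod : a p * b p = a p₀ * b p₀ := (hm p hp).trans (hm p₀ hp₀).symm
    have : (a p - a p₀) * (a p - b p₀) = 0 := by linear_combination a p * hsum - hprod
    rcases mul_eq_zero.1 this with h | h
    · exact Or.inl ⟨by linarith, by linarith⟩
    · exact Or.inr ⟨by linarith, by linarith⟩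
  have hab : a p₀ = b p₀ := hS.eq_of_constant_curvatures hp₀ (fun q hq => by
    obtain ⟨w₁, w₂, hw⟩ := hframe q hq
    rcases hcases q hq with ⟨h1, h2⟩ | ⟨h1, h2⟩ <;> rw [h1, h2] at hw
    · exact ⟨w₁, w₂, hw⟩
    · exact ⟨w₂, w₁, hw.swap⟩) (ha p₀ hp₀) (hb p₀ hp₀)
  refine ⟨a p₀, b p₀, fun p hp => (hcases p hp).elim id fun h => ?_⟩
  exact ⟨h.1.trans hab.symm, h.2.trans hab⟩
end
end
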